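/- arXiv:0907.0748 — 7 statements merged into one kernel-verified Lean document; each statement's English description precedes it below -/
import Mathlib

section
/- Let N ≥ 2, let G be a connected simple graph on the vertex set Fin N, and let (σ_t)_{t∈ℕ} be an i.i.d. sequence of edge-valued random variables on a probability space (Ω, P) such that P(σ_t = e) > 0 for every edge e of G. Given an arbitrary initial vector n(0) ∈ ℤ^N, define the random process n : ℕ → ℤ^N by: if σ_t = {i, j}, then n_{t+1}(i) = ⌊n_t(i)/2⌋ + ⌈n_t(j)/2⌉ and n_{t+1}(j) = ⌊n_t(j)/2⌋ + ⌈n_t(i)/2⌉, while n_{t+1}(h) = n_t(h) for every h ∉ {i, j}. Then almost surely there exists T ∈ ℕ such that for all t ≥ T, n(t) belongs to the set R = {r ∈ ℤ^N : ∃ α ∈ ℤ such that r_i − α ∈ {0, 1} for every i}. -/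
open MeasureTheory

namespace Gossip

variable {N : ℕ} {G : SimpleGraph (Fin N)}

/-- One gossip exchange along the oriented edge `d`. -/
def step (x : Fin N → ℤ) (d : G.Dart) : Fin N → ℤ := fun h =>
  if h = d.fst then x d.fst / 2 + (x d.snd + 1) / 2
  else if h = d.snd then x d.snd / 2 + (x d.fst + 1) / 2
  else x h

/-- The state reached from `x` by performing the exchanges of `W` in order. -/
def run (W : List G.Dart) (x : Fin N → ℤ) : Fin N → ℤ := W.foldl step x

/-- The set of states whose entries take values in `{α, α + 1}` for some integer `α`. -/
def target (N : ℕ) : Set (Fin N → ℤ) := {x | ∃ α : ℤ, ∀ i, x i ∈ Set.Icc α (α + 1)}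

/-- The potential that gossip exchanges never increase. -/
def energy (x : Fin N → ℤ) : ℤ := ∑ i, x i ^ 2

/-- From `x` no sequence of exchanges creates a gap of two or more across an edge. -/
def IsStuck (G : SimpleGraph (Fin N)) (x : Fin N → ℤ) : Prop :=
  ∀ (W : List G.Dart) (d : G.Dart), |run W x d.fst - run W x d.snd| ≤ 1

lemma step_fst (x : Fin N → ℤ) (d : G.Dart) :
    step x d d.fst = x d.fst / 2 + (x d.snd + 1) / 2 := by simp [step]

lemma step_snd (x : Fin N → ℤ) (d : G.Dart) :
    step x d d.snd = x d.snd / 2 + (x d.fst + 1) / 2 := by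
  simp [step, d.adj.ne']

lemma step_of_ne (x : Fin N → ℤ) (d : G.Dart) {h : Fin N} (h₁ : h ≠ d.fst) (h₂ : h ≠ d.snd) :
    step x d h = x h := by simp [step, h₁, h₂]

lemma step_mem_Icc {a b : ℤ} {x : Fin N → ℤ} (hx : ∀ i, x i ∈ Set.Icc a b) (d : G.Dart)
    (i : Fin N) :
    step x d i ∈ Set.Icc a b := by
  have h₁ := hx d.fst
  have h₂ := hx d.snd
  have h₃ := hx i
  simp only [Set.mem_Icc, step] at *
  split_ifs <;> omega

lemma step_mem_target {x : Fin N → ℤ} (hx : x ∈ target N) (d : G.Dart) : step x d ∈ target N :=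
  hx.imp fun _ hα => step_mem_Icc hα d

lemma run_append (W W' : List G.Dart) (x : Fin N → ℤ) : run (W ++ W') x = run W' (run W x) :=
  List.foldl_append

lemma run_mem_target (W : List G.Dart) {x : Fin N → ℤ} (hx : x ∈ target N) :
    run W x ∈ target N := by
  induction W generalizing x with
  | nil => exact hx
  | cons d W ih => exact ih (step_mem_target hx d)

lemma energy_eq (x : Fin N → ℤ) {i j : Fin N} (hij : i ≠ j) :
    energy x = x i ^ 2 + (x j ^ 2 + ∑ k ∈ (Finset.univ.erase i).erase j, x k ^ 2) := by
  rw [energy, Finset.add_sum_erase _ (fun k => x k ^ 2) (by simp [hij.symm]),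
    Finset.add_sum_erase _ (fun k => x k ^ 2) (Finset.mem_univ i)]

lemma energy_step_sub (x : Fin N → ℤ) (d : G.Dart) :
    energy (step x d) - energy x = (x d.fst / 2 + (x d.snd + 1) / 2) ^ 2 +
      (x d.snd / 2 + (x d.fst + 1) / 2) ^ 2 - (x d.fst ^ 2 + x d.snd ^ 2) := by
  have hsum : ∑ k ∈ (Finset.univ.erase d.fst).erase d.snd, step x d k ^ 2 =
      ∑ k ∈ (Finset.univ.erase d.fst).erase d.snd, x k ^ 2 := by
    refine Finset.sum_congr rfl fun k hk => ?_
    simp only [Finset.mem_erase] at hk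
    rw [step_of_ne x d hk.2.1 hk.1]
  rw [energy_eq _ d.adj.ne, energy_eq x d.adj.ne, hsum, step_fst, step_snd]
  ring

lemma energy_step_le (x : Fin N → ℤ) (d : G.Dart) : energy (step x d) ≤ energy x := by
  have h := energy_step_sub x d
  generalize x d.fst = a at h
  generalize x d.snd = b at h
  have hs : (a / 2 + (b + 1) / 2) + (b / 2 + (a + 1) / 2) = a + b := by omega
  have hd : |(a / 2 + (b + 1) / 2) - (b / 2 + (a + 1) / 2)| ≤ |a - b| := by grind
  generalize a / 2 + (b + 1) / 2 = a' at *
  generalize b / 2 + (a + 1) / 2 = b' at *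
  have := sq_le_sq.2 hd
  have : (a' + b') ^ 2 = (a + b) ^ 2 := by rw [hs]
  nlinarith

lemma energy_step_lt {x : Fin N → ℤ} {d : G.Dart} (hd : 1 < |x d.fst - x d.snd|) :
    energy (step x d) < energy x := by
  have h := energy_step_sub x d
  generalize x d.fst = a at h hd
  generalize x d.snd = b at h hd
  have hs : (a / 2 + (b + 1) / 2) + (b / 2 + (a + 1) / 2) = a + b := by omega
  have hd : |(a / 2 + (b + 1) / 2) - (b / 2 + (a + 1) / 2)| < |a - b| := by grind
  generalize a / 2 + (b + 1) / 2 = a' at *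
  generalize b / 2 + (a + 1) / 2 = b' at *
  have := sq_lt_sq.2 hd
  have : (a' + b') ^ 2 = (a + b) ^ 2 := by rw [hs]
  nlinarith

lemma energy_run_le (W : List G.Dart) (x : Fin N → ℤ) : energy (run W x) ≤ energy x := by
  induction W generalizing x with
  | nil => exact le_rfl
  | cons d W ih => exact (ih _).trans (energy_step_le x d)

lemma energy_nonneg (x : Fin N → ℤ) : 0 ≤ energy x := Finset.sum_nonneg fun _ _ => sq_nonneg _

lemma IsStuck.step {x : Fin N → ℤ} (hx : IsStuck G x) (d : G.Dart) : IsStuck G (step x d) :=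
  fun W => hx (d :: W)

/-- In a stuck state, a gap of two between the ends of a shortest offending walk could be moved
one edge closer by exchanging an even value with the odd value above it, at one of the two ends. -/
lemma IsStuck.abs_sub_le_of_walk (m : ℕ) : ∀ {x : Fin N → ℤ}, IsStuck G x →
    ∀ {u v : Fin N} (p : G.Walk u v), p.length = m → |x u - x v| ≤ 1 := by
  induction m with
  | zero =>
    intro x _ u v p hp
    obtain rfl := SimpleGraph.Walk.eq_of_length_eq_zero hp
    simp
  | succ m ih =>
    have swap : ∀ {x : Fin N → ℤ}, IsStuck G x → ∀ {u w v : Fin N} (h : G.Adj u w)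
        (q : G.Walk w v), q.length = m → v ≠ u → v ≠ w →
        |(x w / 2 + (x u + 1) / 2) - x v| ≤ 1 := by
      intro x hx u w v h q hq hvu hvw
      have := ih (hx.step ⟨(u, w), h⟩) q hq
      rwa [step_of_ne x ⟨(u, w), h⟩ hvu hvw, step_snd x ⟨(u, w), h⟩] at this
    intro x hx u v p hp
    by_contra! hgap
    have huv : u ≠ v := by rintro rfl; simp at hgap
    obtain ⟨w, h, q, rfl⟩ := SimpleGraph.Walk.exists_eq_cons_of_ne huv p
    obtain ⟨w', h', q', hr⟩ :=
      SimpleGraph.Walk.exists_eq_cons_of_ne huv.symm (SimpleGraph.Walk.cons h q).reverse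
    have hq : q.length = m := by simpa using hp
    have hq' : q'.length = m := by
      have := congrArg SimpleGraph.Walk.length hr
      rw [SimpleGraph.Walk.length_reverse, SimpleGraph.Walk.length_cons,
        SimpleGraph.Walk.length_cons] at this
      omega
    have h₁ := ih hx q hq
    have h₂ := ih hx q' hq'
    have h₃ : |x u - x w| ≤ 1 := hx [] ⟨(u, w), h⟩
    have h₄ : |x v - x w'| ≤ 1 := hx [] ⟨(v, w'), h'⟩
    have hvw : v ≠ w := by rintro rfl; omega
    have huw' : u ≠ w' := by rintro rfl; rw [abs_sub_comm] at h₄; omega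
    have h₅ := swap hx h q hq huv.symm hvw
    have h₆ := swap hx h' q' hq' huv huw'
    rw [abs_le] at *
    rw [lt_abs] at hgap
    omega

lemma IsStuck.mem_target (hN : 0 < N) (hG : G.Connected) {x : Fin N → ℤ} (hx : IsStuck G x) :
    x ∈ target N := by
  have : Nonempty (Fin N) := ⟨⟨0, hN⟩⟩
  obtain ⟨i, hi⟩ := Finite.exists_min x
  refine ⟨x i, fun j => ⟨hi j, ?_⟩⟩
  obtain ⟨p⟩ := hG.preconnected j i
  have := (abs_le.1 (hx.abs_sub_le_of_walk _ p rfl)).2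
  omega

lemma exists_run_mem_target (hN : 0 < N) (hG : G.Connected) (x : Fin N → ℤ) :
    ∃ W : List G.Dart, run W x ∈ target N := by
  induction hE : (energy x).toNat using Nat.strong_induction_on generalizing x with
  | _ E ih =>
    by_cases hx : IsStuck G x
    · exact ⟨[], hx.mem_target hN hG⟩
    · simp only [IsStuck, not_forall, not_le] at hx
      obtain ⟨W, d, hd⟩ := hx
      have hlt := (energy_step_lt hd).trans_le (energy_run_le W x)
      have := energy_nonneg (step (run W x) d)
      obtain ⟨W', hW'⟩ := ih _ (by omega) (step (run W x) d) rfl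
      refine ⟨W ++ d :: W', ?_⟩
      rw [run_append]
      exact hW'

lemma exists_forall_run_mem_target (hN : 0 < N) (hG : G.Connected) (S : Finset (Fin N → ℤ)) :
    ∃ W : List G.Dart, ∀ x ∈ S, run W x ∈ target N := by
  classical
  induction S using Finset.induction_on with
  | empty => exact ⟨[], by simp⟩
  | insert x S _ ih =>
    obtain ⟨W, hW⟩ := ih
    obtain ⟨W', hW'⟩ := exists_run_mem_target hN hG (run W x)
    refine ⟨W ++ W', fun y hy => ?_⟩
    rw [run_append]
    rcases Finset.mem_insert.1 hy with rfl | hy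
    · exact hW'
    · exact run_mem_target W' (hW y hy)

lemma eq_run_of_forall_step (W : List G.Dart) (x : ℕ → Fin N → ℤ) (s : ℕ)
    (h : ∀ i (hi : i < W.length), x (s + i + 1) = step (x (s + i)) W[i]) :
    x (s + W.length) = run W (x s) := by
  induction W generalizing s with
  | nil => rfl
  | cons d W ih =>
    have hd := h 0 (by simp)
    have := ih (s + 1) fun i hi => by
      have := h (i + 1) (by simpa using hi)
      simpa [add_assoc, add_comm, add_left_comm] using this
    rw [List.length_cons, ← add_assoc, add_right_comm, this]
    exact congrArg (run W) hd

lemma floor_half (a : ℤ) : ⌊(a : ℚ) / 2⌋ = a / 2 := by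
  exact_mod_cast Rat.floor_intCast_div_natCast a 2

lemma ceil_half (a : ℤ) : ⌈(a : ℚ) / 2⌉ = (a + 1) / 2 := by
  rw [Int.ceil_eq_iff]
  have h : 2 * ((a + 1) / 2) = a ∨ 2 * ((a + 1) / 2) = a + 1 := by omega
  generalize (a + 1) / 2 = c at h
  rcases h with h | h
  · obtain rfl := h
    constructor <;> push_cast <;> linarith
  · obtain rfl : a = 2 * c - 1 := by omega
    constructor <;> push_cast <;> linarith

/-- An i.i.d. sequence almost surely agrees, on some block of length `L`, with any given
`L`-periodic sequence of values of positive probability. -/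
lemma ae_exists_block_eq {Ω E : Type*} [MeasurableSpace Ω] (P : Measure Ω)
    [IsProbabilityMeasure P] (σ : ℕ → Ω → E)
    (hmeas : ∀ (t : ℕ) (e : E), MeasurableSet {ω | σ t ω = e})
    (hiid : ∀ (s : Finset ℕ) (f : ℕ → E),
      P (⋂ t ∈ s, {ω | σ t ω = f t}) = ∏ t ∈ s, P {ω | σ 0 ω = f t})
    (L : ℕ) (f : ℕ → E) (hper : ∀ k i, f (k * L + i) = f i)
    (hpos : ∀ t, 0 < P {ω | σ 0 ω = f t}) :
    ∀ᵐ ω ∂P, ∃ k : ℕ, ∀ i < L, σ (k * L + i) ω = f (k * L + i) := by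
  let block : ℕ → Finset ℕ := fun k => (Finset.range L).map (addLeftEmbedding (k * L))
  let A : ℕ → Set Ω := fun k => ⋂ t ∈ block k, {ω | σ t ω = f t}
  have hA : ∀ k, MeasurableSet (A k) := fun k =>
    Finset.measurableSet_biInter _ fun t _ => hmeas t (f t)
  have hPA : ∀ k, P (A k) = ∏ i ∈ Finset.range L, P {ω | σ 0 ω = f i} := fun k => by
    simp only [A, hiid, block, Finset.prod_map, addLeftEmbedding_apply, hper]
  have hdisj : ∀ s : Finset ℕ, (s : Set ℕ).PairwiseDisjoint block := by
    intro s k _ l _ hkl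
    refine Finset.disjoint_left.2 fun t ht ht' => hkl ?_
    simp only [block, Finset.mem_map, Finset.mem_range, addLeftEmbedding_apply] at ht ht'
    obtain ⟨i, hi, rfl⟩ := ht
    obtain ⟨j, hj, h⟩ := ht'
    have hL : 0 < L := by omega
    have := congrArg (· / L) h
    simpa [Nat.add_div_of_dvd_right, Nat.div_eq_of_lt, hi, hj, hL, hL.ne', eq_comm] using this
  have hind : ProbabilityTheory.iIndepSet A P := by
    rw [ProbabilityTheory.iIndepSet_iff_meas_biInter hA]
    intro s
    have : ⋂ k ∈ s, A k = ⋂ t ∈ s.biUnion block, {ω | σ t ω = f t} := by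
      rw [Finset.set_biInter_biUnion]
    rw [this, hiid, Finset.prod_biUnion (hdisj s)]
    exact Finset.prod_congr rfl fun k _ => (hiid _ _).symm
  have htsum : ∑' k, P (A k) = ⊤ := by
    simp only [hPA]
    exact ENNReal.tsum_const_eq_top_of_ne_zero (Finset.prod_ne_zero_iff.2 fun i _ => (hpos i).ne')
  have hlim := ProbabilityTheory.measure_limsup_eq_one hA hind htsum
  have hae := (mem_ae_iff_prob_eq_one (MeasurableSet.measurableSet_limsup hA)).2 hlim
  filter_upwards [hae] with ω hω
  rw [Filter.limsup_eq_iInf_iSup_of_nat] at hω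
  simp only [Set.iInf_eq_iInter, Set.iSup_eq_iUnion, Set.mem_iInter, Set.mem_iUnion] at hω
  obtain ⟨k, _, hk⟩ := hω 0
  refine ⟨k, fun i hi => ?_⟩
  simp only [A, block, Set.mem_iInter] at hk
  exact hk _ (Finset.mem_map.2 ⟨i, Finset.mem_range.2 hi, rfl⟩)

end Gossip

/-- Symbolic dynamics of the compensating gossip rule with deterministic quantizer:
almost surely the process enters (and stays in) the set
`R = {r : ∃ α, ∀ i, r i - α ∈ {0,1}}` in finite time. -/
theorem stmt_0 {N : ℕ} (hN : 2 ≤ N) (G : SimpleGraph (Fin N)) (hG : G.Connected)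
    {Ω : Type*} [MeasurableSpace Ω] (P : Measure Ω) [IsProbabilityMeasure P]
    (σ : ℕ → Ω → Sym2 (Fin N))
    (hrange : ∀ t ω, σ t ω ∈ G.edgeSet)
    (hmeas : ∀ (t : ℕ) (e : Sym2 (Fin N)), MeasurableSet {ω | σ t ω = e})
    (hiid : ∀ (s : Finset ℕ) (f : ℕ → Sym2 (Fin N)),
      P (⋂ t ∈ s, {ω | σ t ω = f t}) = ∏ t ∈ s, P {ω | σ 0 ω = f t})
    (hpos : ∀ e ∈ G.edgeSet, 0 < P {ω | σ 0 ω = e})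
    (n0 : Fin N → ℤ) (n : ℕ → Ω → Fin N → ℤ)
    (h0 : ∀ ω, n 0 ω = n0)
    (hupd : ∀ (t : ℕ) (ω : Ω) (i j : Fin N), G.Adj i j → σ t ω = s(i, j) →
      n (t+1) ω i = ⌊(n t ω i : ℚ) / 2⌋ + ⌈(n t ω j : ℚ) / 2⌉ ∧
      ∀ h : Fin N, h ≠ i → h ≠ j → n (t+1) ω h = n t ω h) :
    ∀ᵐ ω ∂P, ∃ T : ℕ, ∀ t ≥ T, ∃ α : ℤ, ∀ i, n t ω i - α ∈ ({0, 1} : Set ℤ) := by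
  have hN0 : 0 < N := by omega
  have hstep : ∀ t ω (d : G.Dart), σ t ω = d.edge → n (t + 1) ω = Gossip.step (n t ω) d := by
    intro t ω d hd
    have h₁ := hupd t ω d.fst d.snd d.adj hd
    have h₂ := hupd t ω d.snd d.fst d.adj.symm (hd.trans Sym2.eq_swap)
    simp only [Gossip.floor_half, Gossip.ceil_half] at h₁ h₂
    funext h
    by_cases hf : h = d.fst
    · rw [hf, Gossip.step_fst, h₁.1]
    by_cases hs : h = d.snd
    · rw [hs, Gossip.step_snd, h₂.1]
    rw [Gossip.step_of_ne _ _ hf hs, h₁.2 h hf hs]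
  have hdart : ∀ t ω, ∃ d : G.Dart, n (t + 1) ω = Gossip.step (n t ω) d := by
    intro t ω
    obtain ⟨e, he⟩ : ∃ e, σ t ω = e := ⟨_, rfl⟩
    have hmem := hrange t ω
    rw [he] at hmem
    induction e with
    | _ i j => exact ⟨⟨(i, j), hmem⟩, hstep t ω ⟨(i, j), hmem⟩ he⟩
  have : Nonempty (Fin N) := ⟨⟨0, hN0⟩⟩
  obtain ⟨lo, hlo⟩ := Finite.exists_min n0
  obtain ⟨hi, hhi⟩ := Finite.exists_max n0
  have hbdd : ∀ t ω i, n t ω i ∈ Set.Icc (n0 lo) (n0 hi) := by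
    intro t ω
    induction t with
    | zero => rw [h0]; exact fun i => ⟨hlo i, hhi i⟩
    | succ t ih =>
      obtain ⟨d, hd⟩ := hdart t ω
      rw [hd]
      exact Gossip.step_mem_Icc ih d
  obtain ⟨W₀, hW₀⟩ := Gossip.exists_forall_run_mem_target hN0 hG
    (Finset.Icc (fun _ => n0 lo) (fun _ => n0 hi))
  obtain ⟨ω₀⟩ := nonempty_of_isProbabilityMeasure P
  obtain ⟨d₀, -⟩ := hdart 0 ω₀
  let W := W₀ ++ [d₀]
  have hW : ∀ t ω, Gossip.run W (n t ω) ∈ Gossip.target N := by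
    intro t ω
    rw [Gossip.run_append]
    exact Gossip.run_mem_target _ (hW₀ _ (Finset.mem_Icc.2
      ⟨fun i => (hbdd t ω i).1, fun i => (hbdd t ω i).2⟩))
  have hL : 0 < W.length := by simp [W]
  let f : ℕ → Sym2 (Fin N) := fun t => (W[t % W.length]'(Nat.mod_lt _ hL)).edge
  have hper : ∀ k i, f (k * W.length + i) = f i := fun k i => by
    simp only [f, Nat.mul_add_mod_self_right]
  filter_upwards [Gossip.ae_exists_block_eq P σ hmeas hiid W.length f hper
    fun t => hpos _ (SimpleGraph.Dart.edge_mem _)] with ω ⟨k, hk⟩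
  have hhit : n (k * W.length + W.length) ω ∈ Gossip.target N := by
    rw [Gossip.eq_run_of_forall_step W (fun t => n t ω) (k * W.length) fun i hi => ?_]
    · exact hW _ ω
    · refine hstep _ ω _ ((hk i hi).trans ?_)
      rw [hper]
      simp only [f, Nat.mod_eq_of_lt hi]
  refine ⟨k * W.length + W.length, fun t ht => ?_⟩
  have hmem : n t ω ∈ Gossip.target N := by
    induction t, ht using Nat.le_induction with
    | base => exact hhit
    | succ t _ ih =>
      obtain ⟨d, hd⟩ := hdart t ω
      rw [hd]
      exact Gossip.step_mem_target ih d
  obtain ⟨α, hα⟩ := hmem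
  refine ⟨α, fun i => ?_⟩
  have := hα i
  simp only [Set.mem_Icc, Set.mem_insert_iff, Set.mem_singleton_iff] at this ⊢
  omega
end

section
/- Let N ≥ 2, let G be a connected simple graph on the vertex set Fin N, and let (σ_t)_{t∈ℕ} be an i.i.d. sequence of edge-valued random variables on a probability space (Ω, P) such that P(σ_t = e) > 0 for every edge e of G. Let q_d(z) = ⌊z + 1/2⌋ be the deterministic rounding quantizer. Given x(0) ∈ ℝ^N, define the random process x : ℕ → ℝ^N by: if σ_t = {i, j}, then x_{t+1}(i) = x_t(i) − (1/2)q_d(x_t(i)) + (1/2)q_d(x_t(j)) and x_{t+1}(j) = x_t(j) − (1/2)q_d(x_t(j)) + (1/2)q_d(x_t(i)), while x_{t+1}(h) = x_t(h) for h ∉ {i, j}. Then almost surely there exists T ∈ ℕ such that for all t ≥ T: |x_i(t) − x_j(t)| ≤ 1 for all i, j, and max_i |x_i(t) − x_ave(0)| ≤ 1, where x_ave(0) = (1/N)∑_{i} x_i(0). -/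
open MeasureTheory

lemma Fintype.sum_sub_sum_of_eq_off_pair {V M : Type*} [Fintype V] [AddCommGroup M]
    {f g : V → M} {i j : V}
    (hij : i ≠ j) (h : ∀ v, v ≠ i → v ≠ j → f v = g v) :
    ∑ v, f v - ∑ v, g v = (f i - g i) + (f j - g j) := by
  rw [← Finset.sum_sub_distrib]
  exact Fintype.sum_eq_add i j hij fun v hv => sub_eq_zero.2 (h v hv.1 hv.2)

lemma finite_setOf_sum_sq_le {V : Type*} [Fintype V] (C : ℤ) :
    {k : V → ℤ | ∑ v, k v ^ 2 ≤ C}.Finite := by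
  refine (Set.Finite.pi' fun _ : V => Set.finite_Icc (-C) C).subset fun k hk v => ?_
  have h₁ : k v ^ 2 ≤ C :=
    (Finset.single_le_sum (fun i _ => sq_nonneg (k i)) (Finset.mem_univ v)).trans hk
  rw [Set.mem_Icc, ← abs_le]
  have h₂ : |k v| ≤ |k v| ^ 2 := Int.le_self_sq _
  rw [sq_abs] at h₂
  exact h₂.trans h₁

section IntegerDynamics

variable {V : Type*} [DecidableEq V] {G : SimpleGraph V}

/-- One gossip exchange along a dart, in integer coordinates `k = ⌊2 x⌋`, for which the
quantizer `⌊x + 1/2⌋` reads `(k + 1) / 2`. -/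
def gossipStep (k : V → ℤ) (d : G.Dart) (h : V) : ℤ :=
  if h = d.fst then k d.fst - (k d.fst + 1) / 2 + (k d.snd + 1) / 2
  else if h = d.snd then k d.snd - (k d.snd + 1) / 2 + (k d.fst + 1) / 2
  else k h

/-- All values differ by at most one. -/
def IsBalanced (k : V → ℤ) : Prop := ∀ i j, k i ≤ k j + 1

lemma gossipStep_fst (k : V → ℤ) (d : G.Dart) :
    gossipStep k d d.fst = k d.fst - (k d.fst + 1) / 2 + (k d.snd + 1) / 2 := by
  simp [gossipStep]

lemma gossipStep_snd (k : V → ℤ) (d : G.Dart) :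
    gossipStep k d d.snd = k d.snd - (k d.snd + 1) / 2 + (k d.fst + 1) / 2 := by
  simp [gossipStep, d.adj.ne']

lemma gossipStep_of_ne (k : V → ℤ) (d : G.Dart) {h : V} (h₁ : h ≠ d.fst) (h₂ : h ≠ d.snd) :
    gossipStep k d h = k h := by
  simp [gossipStep, h₁, h₂]

lemma IsBalanced.gossipStep {k : V → ℤ} (hk : IsBalanced k) (d : G.Dart) :
    IsBalanced (gossipStep k d) := by
  have key : ∀ h, ∃ h', _root_.gossipStep k d h = k h' := by
    intro h
    have h₁ := hk d.fst d.snd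
    have h₂ := hk d.snd d.fst
    by_cases hf : h = d.fst
    · subst hf
      rw [gossipStep_fst]
      rcases (by omega : k d.fst - (k d.fst + 1) / 2 + (k d.snd + 1) / 2 = k d.fst ∨
        k d.fst - (k d.fst + 1) / 2 + (k d.snd + 1) / 2 = k d.snd) with h | h
      exacts [⟨_, h⟩, ⟨_, h⟩]
    · by_cases hs : h = d.snd
      · subst hs
        rw [gossipStep_snd]
        rcases (by omega : k d.snd - (k d.snd + 1) / 2 + (k d.fst + 1) / 2 = k d.fst ∨
          k d.snd - (k d.snd + 1) / 2 + (k d.fst + 1) / 2 = k d.snd) with h | h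
        exacts [⟨_, h⟩, ⟨_, h⟩]
      · exact ⟨h, gossipStep_of_ne k d hf hs⟩
  intro i j
  obtain ⟨i', hi⟩ := key i
  obtain ⟨j', hj⟩ := key j
  rw [hi, hj]
  exact hk i' j'

lemma IsBalanced.foldl_gossipStep {k : V → ℤ} (hk : IsBalanced k) (w : List G.Dart) :
    IsBalanced (w.foldl _root_.gossipStep k) := by
  induction w generalizing k with
  | nil => exact hk
  | cons d w ih => exact ih (hk.gossipStep d)

/-- A trajectory following a word of darts ends in the state obtained by applying the word. -/
lemma eq_foldl_gossipStep {y : ℕ → V → ℤ} {e : ℕ → Sym2 V}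
    (hy : ∀ t (d : G.Dart), e t = d.edge → y (t + 1) = gossipStep (y t) d)
    (w : List G.Dart) (s : ℕ) (hw : ∀ r (hr : r < w.length), e (s + r) = (w[r]).edge) :
    y (s + w.length) = w.foldl gossipStep (y s) := by
  induction w generalizing s with
  | nil => rfl
  | cons d w ih =>
    have h₀ := hy s d (hw 0 (by simp))
    have h₁ := ih (s + 1) fun r hr => by
      have := hw (r + 1) (by simpa using hr)
      rw [add_assoc, add_comm 1 r]
      simpa using this
    rw [List.length_cons, List.foldl_cons, ← h₀, ← h₁]
    congr 1
    omega

variable [Fintype V]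

lemma sum_sq_gossipStep (k : V → ℤ) (d : G.Dart) :
    ∑ v, gossipStep k d v ^ 2 = ∑ v, k v ^ 2 -
      2 * (((k d.fst + 1) / 2 - (k d.snd + 1) / 2) *
        (k d.fst - k d.snd - ((k d.fst + 1) / 2 - (k d.snd + 1) / 2))) := by
  have := Fintype.sum_sub_sum_of_eq_off_pair (f := fun v => gossipStep k d v ^ 2)
    (g := fun v => k v ^ 2) d.adj.ne fun v h₁ h₂ => by
      simp only [gossipStep_of_ne k d h₁ h₂]
  simp only [gossipStep_fst, gossipStep_snd] at this
  linear_combination this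

lemma sum_sq_gossipStep_le (k : V → ℤ) (d : G.Dart) :
    ∑ v, gossipStep k d v ^ 2 ≤ ∑ v, k v ^ 2 := by
  rw [sum_sq_gossipStep]
  have : 0 ≤ ((k d.fst + 1) / 2 - (k d.snd + 1) / 2) *
        (k d.fst - k d.snd - ((k d.fst + 1) / 2 - (k d.snd + 1) / 2)) := by
    rcases le_total (k d.fst) (k d.snd) with h | h
    · exact mul_nonneg_of_nonpos_of_nonpos (by omega) (by omega)
    · exact mul_nonneg (by omega) (by omega)
  linarith

lemma sum_sq_gossipStep_lt (k : V → ℤ) (d : G.Dart) (hd : 2 ≤ |k d.fst - k d.snd|) :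
    ∑ v, gossipStep k d v ^ 2 < ∑ v, k v ^ 2 := by
  rw [sum_sq_gossipStep]
  have : 0 < ((k d.fst + 1) / 2 - (k d.snd + 1) / 2) *
        (k d.fst - k d.snd - ((k d.fst + 1) / 2 - (k d.snd + 1) / 2)) := by
    rcases le_abs.1 hd with h | h
    · exact mul_pos (by omega) (by omega)
    · exact mul_pos_of_neg_of_neg (by omega) (by omega)
  linarith

/-- Two values at distance at least two can be brought together along a walk joining them, so
that the sum of squares decreases. -/
lemma exists_sum_sq_foldl_lt_of_walk (n : ℕ) (k : V → ℤ) {u v : V} (p : G.Walk u v)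
    (hp : p.length = n) (huv : 2 ≤ |k u - k v|) :
    ∃ w : List G.Dart, ∑ i, w.foldl gossipStep k i ^ 2 < ∑ i, k i ^ 2 := by
  induction n generalizing k u v with
  | zero =>
    have := SimpleGraph.Walk.eq_of_length_eq_zero hp
    subst this
    simp at huv
  | succ n ih =>
    have advance : ∀ {a b : V} (q : G.Walk a b), q.length = n + 1 → 2 ≤ |k a - k b| →
        (k b = k a + 2 → k a % 2 = 0) → (k a = k b + 2 → k a % 2 = 1) →
        ∃ w : List G.Dart, ∑ i, w.foldl gossipStep k i ^ 2 < ∑ i, k i ^ 2 := by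
      intro a b q hq hab hlow hhigh
      cases q with
      | nil => simp at hq
      | @cons _ c _ hac q =>
        have hq' : q.length = n := by simpa using hq
        by_cases hac2 : 2 ≤ |k a - k c|
        · exact ⟨[⟨(a, c), hac⟩], sum_sq_gossipStep_lt k ⟨(a, c), hac⟩ hac2⟩
        by_cases hcb2 : 2 ≤ |k c - k b|
        · exact ih k q hq' hcb2
        -- The value of `a` moves to its neighbour `c`, one step closer to `b`.
        have hba : b ≠ a := by rintro rfl; simp at hab
        have hbc : b ≠ c := by rintro rfl; exact hac2 hab
        let d : G.Dart := ⟨(a, c), hac⟩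
        have hc : gossipStep k d c = k a := by
          have : gossipStep k d c = k c - (k c + 1) / 2 + (k a + 1) / 2 := gossipStep_snd k d
          rw [this]
          grind
        have hb : gossipStep k d b = k b := gossipStep_of_ne k d hba hbc
        obtain ⟨w, hw⟩ := ih (gossipStep k d) q hq' (by rwa [hc, hb])
        exact ⟨d :: w, hw.trans_le (sum_sq_gossipStep_le k d)⟩
    by_cases hgood : (k v = k u + 2 → k u % 2 = 0) ∧ (k u = k v + 2 → k u % 2 = 1)
    · exact advance p hp huv hgood.1 hgood.2
    · refine advance p.reverse (by simpa using hp) (by rwa [abs_sub_comm]) ?_ ?_ <;> omega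

lemma exists_foldl_gossipStep_isBalanced (hG : G.Connected) (k : V → ℤ) :
    ∃ w : List G.Dart, IsBalanced (w.foldl gossipStep k) := by
  induction hm : (∑ i, k i ^ 2).toNat using Nat.strong_induction_on generalizing k with
  | _ m ih =>
    by_cases hk : IsBalanced k
    · exact ⟨[], hk⟩
    · simp only [IsBalanced, not_forall, not_le] at hk
      obtain ⟨i, j, hij⟩ := hk
      obtain ⟨p⟩ := hG.preconnected i j
      obtain ⟨w, hw⟩ := exists_sum_sq_foldl_lt_of_walk _ k p rfl (le_abs.2 (.inl (by omega)))
      have hnonneg : 0 ≤ ∑ i, w.foldl gossipStep k i ^ 2 :=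
        Finset.sum_nonneg fun _ _ => sq_nonneg _
      obtain ⟨w', hw'⟩ := ih _ (by omega) (w.foldl gossipStep k) rfl
      exact ⟨w ++ w', by rwa [List.foldl_append]⟩

/-- A single word balances all states of a finite set. -/
lemma exists_foldl_gossipStep_isBalanced_of_finset (hG : G.Connected) (F : Finset (V → ℤ)) :
    ∃ w : List G.Dart, ∀ k ∈ F, IsBalanced (w.foldl gossipStep k) := by
  classical
  induction F using Finset.induction_on with
  | empty => exact ⟨[], by simp⟩
  | insert a F _ ih =>
    obtain ⟨w, hw⟩ := ih
    obtain ⟨w', hw'⟩ := exists_foldl_gossipStep_isBalanced hG (w.foldl gossipStep a)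
    refine ⟨w ++ w', fun k hk => ?_⟩
    rw [List.foldl_append]
    rcases Finset.mem_insert.1 hk with rfl | hk
    · exact hw'
    · exact (hw k hk).foldl_gossipStep w'

end IntegerDynamics

/-- A word of letters of positive probability almost surely appears in some aligned block of an
i.i.d. sequence. -/
lemma ae_exists_block_eq {α Ω : Type*} [MeasurableSpace Ω] (P : Measure Ω)
    [IsProbabilityMeasure P] (σ : ℕ → Ω → α)
    (hmeas : ∀ (t : ℕ) (e : α), MeasurableSet {ω | σ t ω = e})
    (hiid : ∀ (s : Finset ℕ) (f : ℕ → α),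
      P (⋂ t ∈ s, {ω | σ t ω = f t}) = ∏ t ∈ s, P {ω | σ 0 ω = f t})
    (w : ℕ → α) (L : ℕ) (hpos : ∀ r < L, P {ω | σ 0 ω = w r} ≠ 0) :
    ∀ᵐ ω ∂P, ∃ m : ℕ, ∀ r < L, σ (m * L + r) ω = w r := by
  classical
  let B : ℕ → Finset ℕ := fun m => (Finset.range L).map (addLeftEmbedding (m * L))
  let f : ℕ → α := fun t => w (t % L)
  let E : ℕ → Set Ω := fun m => ⋂ t ∈ B m, {ω | σ t ω = f t}
  have hEmeas : ∀ m, MeasurableSet (E m) := fun m =>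
    Finset.measurableSet_biInter _ fun t _ => hmeas t _
  have hf : ∀ m, ∀ r < L, f (m * L + r) = w r := fun m r hr => by
    simp [f, Nat.mul_add_mod_self_right, Nat.mod_eq_of_lt hr]
  have hPE : ∀ m, P (E m) = ∏ r ∈ Finset.range L, P {ω | σ 0 ω = w r} := fun m => by
    rw [hiid, Finset.prod_map]
    refine Finset.prod_congr rfl fun r hr => ?_
    rw [addLeftEmbedding_apply, hf m r (Finset.mem_range.1 hr)]
  have hdisj : Pairwise (Function.onFun Disjoint B) := by
    intro a b hab
    refine Finset.disjoint_left.2 fun t ha hb => hab ?_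
    simp only [B, Finset.mem_map, Finset.mem_range, addLeftEmbedding_apply] at ha hb
    obtain ⟨r, hr, rfl⟩ := ha
    obtain ⟨r', hr', h⟩ := hb
    have hL : 0 < L := by omega
    have := congrArg (· / L) h
    simp only [mul_comm _ L, Nat.mul_add_div hL, Nat.div_eq_of_lt hr, Nat.div_eq_of_lt hr'] at this
    omega
  have hind : ProbabilityTheory.iIndepSet E P := by
    rw [ProbabilityTheory.iIndepSet_iff_meas_biInter hEmeas]
    intro S
    have hS : ⋂ m ∈ S, E m = ⋂ t ∈ S.biUnion B, {ω | σ t ω = f t} := by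
      rw [Finset.set_biInter_biUnion]
    rw [hS, hiid, Finset.prod_biUnion fun a _ b _ hab => hdisj hab]
    exact Finset.prod_congr rfl fun m _ => (hiid _ _).symm
  have hsum : ∑' m, P (E m) = ⊤ := by
    simp only [hPE]
    exact ENNReal.tsum_const_eq_top_of_ne_zero
      (Finset.prod_ne_zero_iff.2 fun r hr => hpos r (Finset.mem_range.1 hr))
  have hlim := ProbabilityTheory.measure_limsup_eq_one hEmeas hind hsum
  have hae : ∀ᵐ ω ∂P, ω ∈ Filter.limsup E Filter.atTop :=
    (prob_compl_eq_zero_iff (MeasurableSet.measurableSet_limsup hEmeas)).2 hlim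
  filter_upwards [hae] with ω hω
  obtain ⟨m, hm⟩ := (Filter.mem_limsup_iff_frequently_mem.1 hω).exists
  refine ⟨m, fun r hr => ?_⟩
  have : σ (m * L + r) ω = f (m * L + r) := by
    simp only [E, Set.mem_iInter] at hm
    exact hm _ (Finset.mem_map.2 ⟨r, Finset.mem_range.2 hr, rfl⟩)
  rw [this, hf m r hr]

lemma Int.floor_add_half_eq_floor_two_mul (z : ℝ) : ⌊z + 1 / 2⌋ = (⌊2 * z⌋ + 1) / 2 := by
  have h₁ := Int.floor_le (z + 1 / 2)
  have h₂ := Int.lt_floor_add_one (z + 1 / 2)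
  have h₃ : 2 * ⌊z + 1 / 2⌋ - 1 ≤ ⌊2 * z⌋ := Int.le_floor.2 (by push_cast; linarith)
  have h₄ : ⌊2 * z⌋ < 2 * ⌊z + 1 / 2⌋ + 1 := Int.floor_lt.2 (by push_cast; linarith)
  omega

lemma floor_two_mul_exchange (a b : ℝ) :
    ⌊2 * (a - (1 / 2) * ((⌊a + 1 / 2⌋ : ℤ) : ℝ) + (1 / 2) * ((⌊b + 1 / 2⌋ : ℤ) : ℝ))⌋ =
      ⌊2 * a⌋ - (⌊2 * a⌋ + 1) / 2 + (⌊2 * b⌋ + 1) / 2 := by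
  rw [← Int.floor_add_half_eq_floor_two_mul, ← Int.floor_add_half_eq_floor_two_mul,
    ← Int.floor_sub_intCast, ← Int.floor_add_intCast]
  congr 1
  ring

lemma abs_sub_average_le {ι : Type*} [Fintype ι] [Nonempty ι] {z : ι → ℝ} {c : ℝ}
    (h : ∀ i j, |z i - z j| ≤ c) (i : ι) : |z i - (Fintype.card ι : ℝ)⁻¹ * ∑ k, z k| ≤ c := by
  have hn : (0 : ℝ) < Fintype.card ι := by exact_mod_cast Fintype.card_pos
  have hz : z i - (Fintype.card ι : ℝ)⁻¹ * ∑ k, z k =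
      (Fintype.card ι : ℝ)⁻¹ * ∑ k, (z i - z k) := by
    rw [Finset.sum_sub_distrib, Finset.sum_const, Finset.card_univ, nsmul_eq_mul]
    field_simp
  rw [hz, abs_mul, abs_of_pos (inv_pos.2 hn), inv_mul_le_iff₀ hn]
  calc |∑ k, (z i - z k)| ≤ ∑ k, |z i - z k| := Finset.abs_sum_le_sum_abs _ _
    _ ≤ ∑ _k : ι, c := Finset.sum_le_sum fun k _ => h i k
    _ = Fintype.card ι * c := by simp

/-- Compensating gossip algorithm with deterministic quantizer `q_d(z) = ⌊z + 1/2⌋`: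
almost surely, in finite time, all states are within 1 of each other and within 1
of the initial average. -/
theorem stmt_1 {N : ℕ} (hN : 2 ≤ N) (G : SimpleGraph (Fin N)) (hG : G.Connected)
    {Ω : Type*} [MeasurableSpace Ω] (P : Measure Ω) [IsProbabilityMeasure P]
    (σ : ℕ → Ω → Sym2 (Fin N))
    (hrange : ∀ t ω, σ t ω ∈ G.edgeSet)
    (hmeas : ∀ (t : ℕ) (e : Sym2 (Fin N)), MeasurableSet {ω | σ t ω = e})
    (hiid : ∀ (s : Finset ℕ) (f : ℕ → Sym2 (Fin N)),
      P (⋂ t ∈ s, {ω | σ t ω = f t}) = ∏ t ∈ s, P {ω | σ 0 ω = f t})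
    (hpos : ∀ e ∈ G.edgeSet, 0 < P {ω | σ 0 ω = e})
    (x0 : Fin N → ℝ) (x : ℕ → Ω → Fin N → ℝ)
    (h0 : ∀ ω, x 0 ω = x0)
    (hupd : ∀ (t : ℕ) (ω : Ω) (i j : Fin N), G.Adj i j → σ t ω = s(i, j) →
      x (t+1) ω i = x t ω i - (1/2) * ((⌊x t ω i + 1/2⌋ : ℤ) : ℝ)
        + (1/2) * ((⌊x t ω j + 1/2⌋ : ℤ) : ℝ) ∧
      ∀ h : Fin N, h ≠ i → h ≠ j → x (t+1) ω h = x t ω h) :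
    ∀ᵐ ω ∂P, ∃ T : ℕ, ∀ t ≥ T,
      (∀ i j, |x t ω i - x t ω j| ≤ 1) ∧
      (∀ i, |x t ω i - (N : ℝ)⁻¹ * ∑ k, x0 k| ≤ 1) := by
  have : Nonempty (Fin N) := ⟨⟨0, by omega⟩⟩
  let y : Ω → ℕ → Fin N → ℤ := fun ω t i => ⌊2 * x t ω i⌋
  have hdart : ∀ ω t, ∃ d : G.Dart, σ t ω = d.edge := fun ω t => by
    have := hrange t ω
    induction h : σ t ω with
    | _ i j =>
      rw [h] at this
      exact ⟨⟨(i, j), this⟩, rfl⟩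
  have hupd' : ∀ ω t (d : G.Dart), σ t ω = d.edge →
      x (t+1) ω d.fst = x t ω d.fst - (1/2) * ((⌊x t ω d.fst + 1/2⌋ : ℤ) : ℝ)
        + (1/2) * ((⌊x t ω d.snd + 1/2⌋ : ℤ) : ℝ) ∧
      x (t+1) ω d.snd = x t ω d.snd - (1/2) * ((⌊x t ω d.snd + 1/2⌋ : ℤ) : ℝ)
        + (1/2) * ((⌊x t ω d.fst + 1/2⌋ : ℤ) : ℝ) ∧
      ∀ h : Fin N, h ≠ d.fst → h ≠ d.snd → x (t+1) ω h = x t ω h := fun ω t d hd => by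
    have h₁ := hupd t ω d.fst d.snd d.adj hd
    have h₂ := hupd t ω d.snd d.fst d.adj.symm (hd.trans Sym2.eq_swap)
    exact ⟨h₁.1, h₂.1, h₁.2⟩
  have hstep : ∀ ω t (d : G.Dart), σ t ω = d.edge → y ω (t + 1) = gossipStep (y ω t) d := by
    intro ω t d hd
    obtain ⟨h₁, h₂, h₃⟩ := hupd' ω t d hd
    funext h
    by_cases hf : h = d.fst
    · subst hf
      rw [gossipStep_fst]
      simp only [y, h₁, floor_two_mul_exchange]
    by_cases hs : h = d.snd
    · subst hs
      rw [gossipStep_snd]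
      simp only [y, h₂, floor_two_mul_exchange]
    rw [gossipStep_of_ne _ _ hf hs]
    simp only [y, h₃ h hf hs]
  have hsum : ∀ ω t, ∑ k, x t ω k = ∑ k, x0 k := by
    intro ω t
    induction t with
    | zero => rw [h0]
    | succ t ih =>
      obtain ⟨d, hd⟩ := hdart ω t
      obtain ⟨h₁, h₂, h₃⟩ := hupd' ω t d hd
      have := Fintype.sum_sub_sum_of_eq_off_pair d.adj.ne h₃
      rw [h₁, h₂] at this
      linarith
  have hbound : ∀ ω t, ∑ v, y ω t v ^ 2 ≤ ∑ v, ⌊2 * x0 v⌋ ^ 2 := by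
    intro ω t
    induction t with
    | zero => simp only [y, h0, le_refl]
    | succ t ih =>
      obtain ⟨d, hd⟩ := hdart ω t
      rw [hstep ω t d hd]
      exact (sum_sq_gossipStep_le _ d).trans ih
  have hfin := finite_setOf_sum_sq_le (V := Fin N) (∑ v, ⌊2 * x0 v⌋ ^ 2)
  obtain ⟨w, hw⟩ := exists_foldl_gossipStep_isBalanced_of_finset hG hfin.toFinset
  let v₀ : Fin N := Classical.arbitrary _
  let letter : ℕ → Sym2 (Fin N) := fun r => (w.map SimpleGraph.Dart.edge).getD r s(v₀, v₀)
  have hletter : ∀ r (hr : r < w.length), letter r = (w[r]).edge := fun r hr => by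
    simp [letter, hr]
  have hae := ae_exists_block_eq P σ hmeas hiid letter w.length fun r hr => by
    rw [hletter r hr]
    exact (hpos _ (w[r]).edge_mem).ne'
  filter_upwards [hae] with ω hω
  obtain ⟨m, hm⟩ := hω
  refine ⟨m * w.length + w.length, fun t ht => ?_⟩
  have hbal : IsBalanced (y ω t) := by
    induction t, ht using Nat.le_induction with
    | base =>
      rw [eq_foldl_gossipStep (hstep ω) w _ fun r hr => (hm r hr).trans (hletter r hr)]
      exact hw _ (hfin.mem_toFinset.2 (hbound ω _))
    | succ t _ ih =>
      obtain ⟨d, hd⟩ := hdart ω t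
      rw [hstep ω t d hd]
      exact ih.gossipStep d
  have hle : ∀ i j, x t ω i - x t ω j ≤ 1 := fun i j => by
    have h₁ : (⌊2 * x t ω i⌋ : ℝ) ≤ ⌊2 * x t ω j⌋ + 1 := by exact_mod_cast hbal i j
    have h₂ := Int.lt_floor_add_one (2 * x t ω i)
    have h₃ := Int.floor_le (2 * x t ω j)
    linarith
  have hclose : ∀ i j, |x t ω i - x t ω j| ≤ 1 := fun i j =>
    abs_sub_le_iff.2 ⟨hle i j, hle j i⟩
  refine ⟨hclose, fun i => ?_⟩
  have := abs_sub_average_le hclose i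
  rwa [hsum, Fintype.card_fin] at this
end

section
/- Let N ≥ 2, let G be a connected simple graph on the vertex set Fin N, and let (σ_t)_{t∈ℕ} be an i.i.d. sequence of edge-valued random variables on a probability space (Ω, P) such that P(σ_t = e) > 0 for every edge e of G. Given an arbitrary initial vector n(0) ∈ ℤ^N, define the random process n : ℕ → ℤ^N by: if σ_t = {i, j}, then n_{t+1}(i) = n_{t+1}(j) = ⌈n_t(i)/2⌉ + ⌈n_t(j)/2⌉, while n_{t+1}(h) = n_t(h) for every h ∉ {i, j}. Then almost surely there exists T ∈ ℕ such that for all t ≥ T, n(t) belongs to the set A = {y ∈ ℤ^N : ∃ α ∈ ℤ such that y_i = 2α for every i}. -/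
open MeasureTheory

/-- One step of the quantized gossip rule along the edge `{i, j}`. -/
def IsGossipStep {V : Type*} (x y : V → ℤ) (i j : V) : Prop :=
  y i = ⌈(x i : ℚ) / 2⌉ + ⌈(x j : ℚ) / 2⌉ ∧ y j = ⌈(x i : ℚ) / 2⌉ + ⌈(x j : ℚ) / 2⌉ ∧
    ∀ h, h ≠ i → h ≠ j → y h = x h

lemma ceil_intCast_div_two (z : ℤ) : ⌈(z : ℚ) / 2⌉ = (z + 1) / 2 := by
  rw [Int.ceil_eq_iff]
  have h : z ≤ 2 * ((z + 1) / 2) := by omega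
  have h' : 2 * ((z + 1) / 2) < z + 2 := by omega
  have hq : (z : ℚ) ≤ 2 * (((z + 1) / 2 : ℤ) : ℚ) := by exact_mod_cast h
  have hq' : 2 * (((z + 1) / 2 : ℤ) : ℚ) < z + 2 := by exact_mod_cast h'
  constructor <;> linarith

/-- Averaging with upward rounding strictly decreases the sum of the squared distances of two
distinct integers to a common upper bound. -/
lemma two_mul_sq_sub_ceil_avg_lt {a b B : ℤ} (ha : a ≤ B) (hb : b ≤ B) (hab : a ≠ b) :
    2 * (B - (a + b + 1) / 2) ^ 2 < (B - a) ^ 2 + (B - b) ^ 2 := by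
  obtain ⟨w, hw⟩ : ∃ w, w = (a + b + 1) / 2 := ⟨_, rfl⟩
  rw [← hw]
  have hcases : 2 * w = a + b ∨ 2 * w = a + b + 1 := by omega
  have hsq : 0 < (a - b) ^ 2 := by
    have := sub_ne_zero.mpr hab
    positivity
  rcases hcases with h | h
  · nlinarith
  · have hlt : a + b + 1 ≤ 2 * B := by omega
    nlinarith

namespace IsGossipStep

variable {V : Type*} {x y : V → ℤ} {i j : V}

lemma half_apply (h : IsGossipStep x y i j) (v : V) :
    (v = i ∨ v = j) ∧ (y v + 1) / 2 = ((x i + 1) / 2 + (x j + 1) / 2 + 1) / 2 ∨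
      (v ≠ i ∧ v ≠ j) ∧ (y v + 1) / 2 = (x v + 1) / 2 := by
  obtain ⟨hi, hj, ho⟩ := h
  rw [ceil_intCast_div_two, ceil_intCast_div_two] at hi hj
  by_cases h1 : v = i
  · subst h1; left; simp [hi]
  by_cases h2 : v = j
  · subst h2; left; simp [hj]
  · right; simp [h1, h2, ho v h1 h2]

lemma half_le (h : IsGossipStep x y i j) {B : ℤ} (hB : ∀ v, (x v + 1) / 2 ≤ B) (v : V) :
    (y v + 1) / 2 ≤ B := by
  have hi := hB i
  have hj := hB j
  have hv := hB v
  rcases h.half_apply v with ⟨-, h⟩ | ⟨-, h⟩ <;> omega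

lemma half_eq (h : IsGossipStep x y i j) (hij : (x i + 1) / 2 = (x j + 1) / 2) (v : V) :
    (y v + 1) / 2 = (x v + 1) / 2 := by
  rcases h.half_apply v with ⟨rfl | rfl, h⟩ | ⟨-, h⟩ <;> omega

lemma potential_lt [Fintype V] (h : IsGossipStep x y i j) {B : ℤ}
    (hB : ∀ v, (x v + 1) / 2 ≤ B) (hij : (x i + 1) / 2 ≠ (x j + 1) / 2) :
    ∑ v, (B - (y v + 1) / 2) ^ 2 < ∑ v, (B - (x v + 1) / 2) ^ 2 := by
  have hne : i ≠ j := by rintro rfl; exact hij rfl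
  rw [← sub_pos, ← Finset.sum_sub_distrib, Fintype.sum_eq_add i j hne]
  · have hi : (y i + 1) / 2 = ((x i + 1) / 2 + (x j + 1) / 2 + 1) / 2 := by
      simpa using h.half_apply i
    have hj : (y j + 1) / 2 = ((x i + 1) / 2 + (x j + 1) / 2 + 1) / 2 := by
      simpa using h.half_apply j
    rw [hi, hj]
    linarith [two_mul_sq_sub_ceil_avg_lt (hB i) (hB j) hij]
  · rintro v ⟨hvi, hvj⟩
    rw [h.2.2 v hvi hvj, sub_self]

end IsGossipStep

/-- If every edge of a connected graph is activated infinitely often, the quantized gossip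
dynamics reaches an even consensus in finite time and stays there. -/
theorem exists_forall_ge_eq_two_mul_of_gossip {V : Type*} [Fintype V] [Nontrivial V]
    {G : SimpleGraph V} (hG : G.Connected) {s : ℕ → Sym2 V}
    (hfreq : ∀ e ∈ G.edgeSet, ∃ᶠ t in Filter.atTop, s t = e) {x : ℕ → V → ℤ}
    (hx : ∀ t i j, s t = s(i, j) → IsGossipStep (x t) (x (t + 1)) i j) :
    ∃ T : ℕ, ∀ t ≥ T, ∃ α : ℤ, ∀ i, x t i = 2 * α := by
  have hstep : ∀ t, ∃ i j, s t = s(i, j) := fun t ↦ by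
    induction s t with | _ i j => exact ⟨i, j, rfl⟩
  obtain ⟨B, hB⟩ : ∃ B : ℤ, ∀ t v, (x t v + 1) / 2 ≤ B := by
    obtain ⟨B, hB⟩ := (Set.finite_range fun v ↦ (x 0 v + 1) / 2).bddAbove
    refine ⟨B, fun t ↦ ?_⟩
    induction t with
    | zero => exact fun v ↦ hB ⟨v, rfl⟩
    | succ t ih =>
      obtain ⟨i, j, hij⟩ := hstep t
      exact (hx t i j hij).half_le ih
  set Φ : ℕ → ℤ := fun t ↦ ∑ v, (B - (x t v + 1) / 2) ^ 2 with hΦ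
  have hΦ_nonneg : ∀ t, 0 ≤ Φ t := fun t ↦ Finset.sum_nonneg fun _ _ ↦ sq_nonneg _
  have hanti : Antitone Φ := antitone_nat_of_succ_le fun t ↦ by
    obtain ⟨i, j, hij⟩ := hstep t
    by_cases he : (x t i + 1) / 2 = (x t j + 1) / 2
    · simp only [hΦ, (hx t i j hij).half_eq he, le_refl]
    · exact ((hx t i j hij).potential_lt (hB t) he).le
  obtain ⟨T, hT⟩ : ∃ T, ∀ t, Φ T ≤ Φ t := by
    obtain ⟨T, hT⟩ := exists_minimalFor_of_wellFoundedLT (fun _ ↦ True) (fun t ↦ (Φ t).toNat)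
      ⟨0, trivial⟩
    refine ⟨T, fun t ↦ ?_⟩
    have h1 := hT.2 (j := t) trivial
    have h2 := hΦ_nonneg t
    have h3 := hΦ_nonneg T
    simp only at h1
    omega
  have hactive : ∀ t ≥ T, ∀ i j, s t = s(i, j) → (x t i + 1) / 2 = (x t j + 1) / 2 := by
    intro t ht i j hij
    by_contra he
    have h1 : Φ (t + 1) < Φ t := (hx t i j hij).potential_lt (hB t) he
    have h2 := hT (t + 1)
    have h3 := hanti ht
    omega
  have hconst : ∀ t ≥ T, ∀ v, (x t v + 1) / 2 = (x T v + 1) / 2 := by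
    intro t ht
    induction t, ht using Nat.le_induction with
    | base => exact fun _ ↦ rfl
    | succ t ht ih =>
      intro v
      obtain ⟨i, j, hij⟩ := hstep t
      rw [(hx t i j hij).half_eq (hactive t ht i j hij), ih]
  have hadj : ∀ i j, G.Adj i j → (x T i + 1) / 2 = (x T j + 1) / 2 := by
    intro i j hij
    obtain ⟨t, ht, hst⟩ := Filter.frequently_atTop.mp (hfreq s(i, j) hij) T
    rw [← hconst t ht i, ← hconst t ht j, hactive t ht i j hst]
  obtain ⟨v₀⟩ := hG.nonempty
  have hcons : ∀ t ≥ T, ∀ v, (x t v + 1) / 2 = (x T v₀ + 1) / 2 := by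
    intro t ht v
    rw [hconst t ht]
    obtain ⟨p⟩ := hG.preconnected v v₀
    induction p with
    | nil => rfl
    | cons h _ ih => rw [hadj _ _ h, ih]
  set α := (x T v₀ + 1) / 2
  have hkeep : ∀ t ≥ T, ∀ v, x t v = 2 * α → x (t + 1) v = 2 * α := by
    intro t ht v hv
    obtain ⟨i, j, hij⟩ := hstep t
    obtain ⟨hi, hj, ho⟩ := hx t i j hij
    rw [ceil_intCast_div_two, ceil_intCast_div_two, hcons t ht, hcons t ht, ← two_mul] at hi hj
    by_cases h1 : v = i
    · rw [h1, hi]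
    by_cases h2 : v = j
    · rw [h2, hj]
    · rw [ho v h1 h2, hv]
  have hvertex : ∀ v, ∃ S, ∀ t ≥ S, x t v = 2 * α := by
    intro v
    obtain ⟨w, hw⟩ := hG.preconnected.exists_adj_of_nontrivial v
    obtain ⟨S, hS, hst⟩ := Filter.frequently_atTop.mp (hfreq s(v, w) hw) T
    refine ⟨S + 1, fun t ht ↦ ?_⟩
    induction t, ht using Nat.le_induction with
    | base =>
      have hv := (hx S v w hst).1
      rwa [ceil_intCast_div_two, ceil_intCast_div_two, hcons S hS, hcons S hS, ← two_mul] at hv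
    | succ t ht ih => exact hkeep t (by omega) v ih
  choose S hS using hvertex
  exact ⟨Finset.univ.sup S, fun t ht ↦
    ⟨α, fun i ↦ hS i t ((Finset.le_sup (Finset.mem_univ i)).trans ht)⟩⟩

/-- Independent events of constant positive probability occur infinitely often almost surely. -/
lemma ae_frequently_of_measure_biInter_eq_pow {Ω : Type*} [MeasurableSpace Ω] {P : Measure Ω}
    [IsProbabilityMeasure P] {E : ℕ → Set Ω} (hE : ∀ t, MeasurableSet (E t)) {p : ENNReal}
    (hp : p ≠ 0) (hind : ∀ s : Finset ℕ, P (⋂ t ∈ s, E t) = p ^ s.card) :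
    ∀ᵐ ω ∂P, ∃ᶠ t in Filter.atTop, ω ∈ E t := by
  have hP : ∀ t, P (E t) = p := fun t ↦ by simpa using hind {t}
  have hindep : ProbabilityTheory.iIndepSet E P := by
    rw [ProbabilityTheory.iIndepSet_iff_meas_biInter hE]
    intro s
    simp [hind, hP]
  have h := ProbabilityTheory.measure_limsup_eq_one hE hindep
    (by simp [hP, ENNReal.tsum_const_eq_top_of_ne_zero hp])
  have hmem : ∀ᵐ ω ∂P, ω ∈ Filter.limsup E Filter.atTop :=
    (mem_ae_iff_prob_eq_one (MeasurableSet.measurableSet_limsup hE)).2 h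
  filter_upwards [hmem] with ω hω
  exact Filter.mem_limsup_iff_frequently_mem.mp hω

/-- Symbolic dynamics of the totally quantized gossip rule with deterministic quantizer:
almost surely the process enters (and stays in) the set
`A = {y : ∃ α, ∀ i, y i = 2α}` in finite time. -/
theorem stmt_2 {N : ℕ} (hN : 2 ≤ N) (G : SimpleGraph (Fin N)) (hG : G.Connected)
    {Ω : Type*} [MeasurableSpace Ω] (P : Measure Ω) [IsProbabilityMeasure P]
    (σ : ℕ → Ω → Sym2 (Fin N))
    (hrange : ∀ t ω, σ t ω ∈ G.edgeSet)
    (hmeas : ∀ (t : ℕ) (e : Sym2 (Fin N)), MeasurableSet {ω | σ t ω = e})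
    (hiid : ∀ (s : Finset ℕ) (f : ℕ → Sym2 (Fin N)),
      P (⋂ t ∈ s, {ω | σ t ω = f t}) = ∏ t ∈ s, P {ω | σ 0 ω = f t})
    (hpos : ∀ e ∈ G.edgeSet, 0 < P {ω | σ 0 ω = e})
    (n0 : Fin N → ℤ) (n : ℕ → Ω → Fin N → ℤ)
    (h0 : ∀ ω, n 0 ω = n0)
    (hupd : ∀ (t : ℕ) (ω : Ω) (i j : Fin N), G.Adj i j → σ t ω = s(i, j) →
      n (t+1) ω i = ⌈(n t ω i : ℚ) / 2⌉ + ⌈(n t ω j : ℚ) / 2⌉ ∧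
      ∀ h : Fin N, h ≠ i → h ≠ j → n (t+1) ω h = n t ω h) :
    ∀ᵐ ω ∂P, ∃ T : ℕ, ∀ t ≥ T, ∃ α : ℤ, ∀ i, n t ω i = 2 * α := by
  have : Nontrivial (Fin N) := Fin.nontrivial_iff_two_le.mpr hN
  have hfreq : ∀ᵐ ω ∂P, ∀ e ∈ G.edgeSet, ∃ᶠ t in Filter.atTop, σ t ω = e := by
    rw [ae_ball_iff (Set.to_countable _)]
    intro e he
    exact ae_frequently_of_measure_biInter_eq_pow (E := fun t ↦ {ω | σ t ω = e})
      (fun t ↦ hmeas t e) (hpos e he).ne' fun s ↦ by simpa using hiid s fun _ ↦ e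
  filter_upwards [hfreq] with ω hω
  refine exists_forall_ge_eq_two_mul_of_gossip hG hω fun t i j hij ↦ ?_
  have hadj : G.Adj i j := by simpa [hij] using hrange t ω
  obtain ⟨hi, ho⟩ := hupd t ω i j hadj hij
  obtain ⟨hj, -⟩ := hupd t ω j i hadj.symm (hij.trans Sym2.eq_swap)
  exact ⟨hi, hj.trans (add_comm _ _), ho⟩
end

section
/- Let N ≥ 2, let G be a connected simple graph on the vertex set Fin N, and let (σ_t)_{t∈ℕ} be an i.i.d. sequence of edge-valued random variables on a probability space (Ω, P) such that P(σ_t = e) > 0 for every edge e of G. Let q_d(z) = ⌊z + 1/2⌋. Given x(0) ∈ ℝ^N, define the random process x : ℕ → ℝ^N by: if σ_t = {i, j}, then x_{t+1}(i) = x_{t+1}(j) = (1/2)q_d(x_t(i)) + (1/2)q_d(x_t(j)), while x_{t+1}(h) = x_t(h) for h ∉ {i, j}. Then almost surely there exist T ∈ ℕ and an integer α ∈ ℤ such that x_i(t) = α for every i ∈ Fin N and every t ≥ T. -/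
open MeasureTheory

/-- Rounding the average of two integers to the nearest integer, ties going up. -/
lemma floor_average_add_half (a b : ℤ) :
    ⌊(1/2) * (a : ℝ) + (1/2) * (b : ℝ) + 1/2⌋ = (a + b + 1) / 2 := by
  have h : (1/2) * (a : ℝ) + (1/2) * (b : ℝ) + 1/2 = ((a + b + 1 : ℤ) : ℝ) / ((2 : ℕ) : ℝ) := by
    push_cast
    ring
  rw [h, Int.floor_div_natCast, Int.floor_intCast]
  rfl

lemma two_mul_two_pow_average_lt {M a b : ℤ} (ha : a ≤ M) (hb : b ≤ M) (hab : a ≠ b) :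
    2 * 2 ^ (M - (a + b + 1) / 2).toNat < 2 ^ (M - a).toNat + 2 ^ (M - b).toNat := by
  wlog h : a < b generalizing a b
  · have := this hb ha hab.symm (by omega)
    rwa [add_comm b a, add_comm (2 ^ _)] at this
  have hle : (M - (a + b + 1) / 2).toNat + 1 ≤ (M - a).toNat := by omega
  have hpow : 2 ^ ((M - (a + b + 1) / 2).toNat + 1) ≤ 2 ^ (M - a).toNat :=
    Nat.pow_le_pow_right two_pos hle
  have hpos : 0 < 2 ^ (M - b).toNat := Nat.two_pow_pos _
  rw [pow_succ] at hpow
  omega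

/-- Replacing two distinct integers by their rounded average strictly decreases the potential
`∑ k, 2 ^ (M - y k)`. -/
lemma sum_two_pow_lt_of_average {V : Type*} [Fintype V] {M : ℤ} {y y' : V → ℤ}
    (hM : ∀ k, y k ≤ M) {i j : V} (hij : y i ≠ y j)
    (hi : y' i = (y i + y j + 1) / 2) (hj : y' j = (y i + y j + 1) / 2)
    (hk : ∀ k, k ≠ i → k ≠ j → y' k = y k) :
    ∑ k, 2 ^ (M - y' k).toNat < ∑ k, 2 ^ (M - y k).toNat := by
  classical
  have hne : i ≠ j := fun h => hij (congrArg y h)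
  have hsplit (f : V → ℕ) : ∑ k, f k = f i + f j + ∑ k ∈ ({i, j} : Finset V)ᶜ, f k := by
    rw [← Finset.sum_pair hne, Finset.sum_add_sum_compl]
  rw [hsplit, hsplit (fun k => 2 ^ (M - y k).toNat)]
  have hrest : ∑ k ∈ ({i, j} : Finset V)ᶜ, 2 ^ (M - y' k).toNat
      = ∑ k ∈ ({i, j} : Finset V)ᶜ, 2 ^ (M - y k).toNat := by
    refine Finset.sum_congr rfl fun k hk' => ?_
    simp only [Finset.mem_compl, Finset.mem_insert, Finset.mem_singleton, not_or] at hk'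
    rw [hk k hk'.1 hk'.2]
  have := two_mul_two_pow_average_lt (hM i) (hM j) hij
  simp only [hrest, hi, hj]
  omega

/-- Integer averaging with rounding along edges of a connected graph reaches a consensus in finite
time as soon as every edge is selected infinitely often. -/
lemma exists_consensus_of_average {V : Type*} [Finite V] {G : SimpleGraph V} (hG : G.Connected)
    {e : ℕ → Sym2 V}
    (hio : ∀ a ∈ G.edgeSet, ∃ᶠ t in Filter.atTop, e t = a) {y : ℕ → V → ℤ}
    (hy : ∀ t i j, e t = s(i, j) →
      y (t + 1) i = (y t i + y t j + 1) / 2 ∧ ∀ k, k ≠ i → k ≠ j → y (t + 1) k = y t k) :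
    ∃ T α, ∀ t ≥ T, ∀ i, y t i = α := by
  have := Fintype.ofFinite V
  obtain ⟨M, hM⟩ : ∃ M, ∀ k, y 0 k ≤ M := by
    obtain ⟨M, hM⟩ := (Set.finite_range (y 0)).bddAbove
    exact ⟨M, fun k => hM ⟨k, rfl⟩⟩
  have step (t) : ∃ i j, e t = s(i, j) ∧ y (t + 1) i = (y t i + y t j + 1) / 2 ∧
      y (t + 1) j = (y t i + y t j + 1) / 2 ∧ ∀ k, k ≠ i → k ≠ j → y (t + 1) k = y t k := by
    obtain ⟨i, j, hij⟩ : ∃ i j, e t = s(i, j) := by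
      induction h : e t using Sym2.ind with
      | _ i j => exact ⟨i, j, rfl⟩
    refine ⟨i, j, hij, (hy t i j hij).1, ?_, (hy t i j hij).2⟩
    rw [(hy t j i (hij.trans Sym2.eq_swap)).1, add_comm (y t j)]
  have hbound (t) : ∀ k, y t k ≤ M := by
    induction t with
    | zero => exact hM
    | succ t ih =>
      obtain ⟨i, j, -, hi, hj, hk⟩ := step t
      intro k
      have := ih i
      have := ih j
      by_cases hki : k = i
      · subst hki; omega
      by_cases hkj : k = j
      · subst hkj; omega
      exact (hk k hki hkj).trans_le (ih k)
  let Φ (t : ℕ) : ℕ := ∑ k, 2 ^ (M - y t k).toNat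
  have hstep (t) : y (t + 1) = y t ∨ Φ (t + 1) < Φ t := by
    obtain ⟨i, j, -, hi, hj, hk⟩ := step t
    by_cases hij : y t i = y t j
    · left
      funext k
      by_cases hki : k = i
      · subst hki; omega
      by_cases hkj : k = j
      · subst hkj; omega
      exact hk k hki hkj
    · exact .inr (sum_two_pow_lt_of_average (hbound t) hij hi hj hk)
  obtain ⟨T, hT⟩ : ∃ T, ∀ t, Φ T ≤ Φ t :=
    ⟨Function.argmin Φ, fun t => Function.argmin_le Φ t⟩
  have hconst : ∀ t ≥ T, y t = y T := by
    intro t ht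
    induction t, ht using Nat.le_induction with
    | base => rfl
    | succ t ht ih =>
      refine (hstep t).elim (fun h => h.trans ih) fun h => absurd (hT (t + 1)) ?_
      have : Φ t = Φ T := by simp only [Φ, ih]
      omega
  have hadj (i j) (hij : G.Adj i j) : y T i = y T j := by
    obtain ⟨t, ht, hte⟩ := Filter.frequently_atTop.1 (hio s(i, j) hij) T
    have h₁ := (hy t i j hte).1
    have h₂ := (hy t j i (hte.trans Sym2.eq_swap)).1
    rw [hconst (t + 1) (by omega), hconst t ht] at h₁ h₂
    omega
  obtain ⟨v⟩ := hG.nonempty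
  refine ⟨T, y T v, fun t ht i => ?_⟩
  rw [hconst t ht]
  obtain ⟨w⟩ := hG.preconnected i v
  induction w with
  | nil => rfl
  | cons h _ ih => exact (hadj _ _ h).trans ih

/-- Deterministic part: if every edge is selected infinitely often, the totally quantized gossip
dynamics reaches a consensus at an integer in finite time. -/
lemma exists_quantized_gossip_consensus {V : Type*} [Finite V] [Nontrivial V] {G : SimpleGraph V}
    (hG : G.Connected) {e : ℕ → Sym2 V}
    (hio : ∀ a ∈ G.edgeSet, ∃ᶠ t in Filter.atTop, e t = a) {x : ℕ → V → ℝ}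
    (hx : ∀ t i j, e t = s(i, j) →
      x (t + 1) i = (1/2) * (⌊x t i + 1/2⌋ : ℝ) + (1/2) * (⌊x t j + 1/2⌋ : ℝ) ∧
        ∀ k, k ≠ i → k ≠ j → x (t + 1) k = x t k) :
    ∃ (T : ℕ) (α : ℤ), ∀ i, ∀ t ≥ T, x t i = α := by
  obtain ⟨T, α, hα⟩ := exists_consensus_of_average hG hio (y := fun t k => ⌊x t k + 1/2⌋)
    fun t i j hij => by
      obtain ⟨h₁, h₂⟩ := hx t i j hij
      refine ⟨?_, fun k hi hj => by rw [h₂ k hi hj]⟩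
      rw [h₁, floor_average_add_half]
  have hupdated (t) (ht : T ≤ t) (i j) (hij : e t = s(i, j)) : x (t + 1) i = α := by
    rw [(hx t i j hij).1, hα t ht i, hα t ht j]
    ring
  have hvertex (i) : ∃ S, ∀ t ≥ S, x t i = α := by
    obtain ⟨j, hj⟩ := hG.preconnected.exists_adj_of_nontrivial i
    obtain ⟨S, hS, hSe⟩ := Filter.frequently_atTop.1 (hio s(i, j) hj) T
    refine ⟨S + 1, fun t ht => ?_⟩
    induction t, ht using Nat.le_induction with
    | base => exact hupdated S hS i j hSe
    | succ t ht ih =>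
      by_cases hi : i ∈ e t
      · obtain ⟨k, hk⟩ := hi
        exact hupdated t (by omega) i k hk
      · induction h : e t using Sym2.ind with
        | _ a b =>
          rw [h, Sym2.mem_iff, not_or] at hi
          exact ((hx t a b h).2 i hi.1 hi.2).trans ih
  choose S hS using hvertex
  obtain ⟨T', hT'⟩ := (Set.finite_range S).bddAbove
  exact ⟨T', α, fun i t ht => hS i t ((hT' ⟨i, rfl⟩).trans ht)⟩

/-- Second Borel–Cantelli lemma for independent events of equal positive probability. -/
lemma ae_frequently_mem_of_measure_biInter_eq_pow {Ω : Type*} [MeasurableSpace Ω] {P : Measure Ω}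
    [IsProbabilityMeasure P] {A : ℕ → Set Ω} (hA : ∀ t, MeasurableSet (A t)) {p : ENNReal}
    (hp : p ≠ 0) (h : ∀ s : Finset ℕ, P (⋂ t ∈ s, A t) = p ^ s.card) :
    ∀ᵐ ω ∂P, ∃ᶠ t in Filter.atTop, ω ∈ A t := by
  have hprob (t) : P (A t) = p := by simpa using h {t}
  have hind : ProbabilityTheory.iIndepSet A P :=
    (ProbabilityTheory.iIndepSet_iff_meas_biInter hA).2 fun s => by simp [h, hprob]
  have hlim : P (Filter.limsup A Filter.atTop) = 1 :=
    ProbabilityTheory.measure_limsup_eq_one hA hind (by simp [hprob, ENNReal.tsum_const, hp])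
  have hae := (prob_compl_eq_zero_iff (MeasurableSet.measurableSet_limsup hA)).2 hlim
  filter_upwards [measure_eq_zero_iff_ae_notMem.1 hae] with ω hω
  rw [Set.notMem_compl_iff] at hω
  exact Filter.mem_limsup_iff_frequently_mem.1 hω

/-- Totally quantized gossip algorithm with deterministic quantizer `q_d(z) = ⌊z + 1/2⌋`:
almost surely the states reach consensus at an integer value in finite time. -/
theorem stmt_3 {N : ℕ} (hN : 2 ≤ N) (G : SimpleGraph (Fin N)) (hG : G.Connected)
    {Ω : Type*} [MeasurableSpace Ω] (P : Measure Ω) [IsProbabilityMeasure P]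
    (σ : ℕ → Ω → Sym2 (Fin N))
    (hrange : ∀ t ω, σ t ω ∈ G.edgeSet)
    (hmeas : ∀ (t : ℕ) (e : Sym2 (Fin N)), MeasurableSet {ω | σ t ω = e})
    (hiid : ∀ (s : Finset ℕ) (f : ℕ → Sym2 (Fin N)),
      P (⋂ t ∈ s, {ω | σ t ω = f t}) = ∏ t ∈ s, P {ω | σ 0 ω = f t})
    (hpos : ∀ e ∈ G.edgeSet, 0 < P {ω | σ 0 ω = e})
    (x0 : Fin N → ℝ) (x : ℕ → Ω → Fin N → ℝ)
    (h0 : ∀ ω, x 0 ω = x0)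
    (hupd : ∀ (t : ℕ) (ω : Ω) (i j : Fin N), G.Adj i j → σ t ω = s(i, j) →
      x (t+1) ω i = (1/2) * ((⌊x t ω i + 1/2⌋ : ℤ) : ℝ)
        + (1/2) * ((⌊x t ω j + 1/2⌋ : ℤ) : ℝ) ∧
      ∀ h : Fin N, h ≠ i → h ≠ j → x (t+1) ω h = x t ω h) :
    ∀ᵐ ω ∂P, ∃ T : ℕ, ∃ α : ℤ, ∀ i, ∀ t ≥ T, x t ω i = (α : ℝ) := by
  have : Nontrivial (Fin N) := Fin.nontrivial_iff_two_le.2 hN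
  have hio : ∀ᵐ ω ∂P, ∀ e ∈ G.edgeSet, ∃ᶠ t in Filter.atTop, σ t ω = e :=
    ae_all_iff.2 fun e => ae_all_iff.2 fun he =>
      ae_frequently_mem_of_measure_biInter_eq_pow (A := fun t => {ω | σ t ω = e})
        (fun t => hmeas t e) (hpos e he).ne' fun s => by simpa using hiid s fun _ => e
  filter_upwards [hio] with ω hω
  refine exists_quantized_gossip_consensus hG hω fun t i j hij => hupd t ω i j ?_ hij
  have hmem := hrange t ω
  rwa [hij] at hmem
end

section
/- Let N ≥ 2, let G be a connected simple graph on the vertex set Fin N. On a probability space (Ω, P), let (σ_t)_{t∈ℕ} be an i.i.d. sequence of edge-valued random variables with P(σ_t = e) > 0 for every edge e of G, and let (ξ_t^1, ξ_t^2)_{t∈ℕ} be i.i.d. pairs of independent Bernoulli(1/2) random variables taking values in {0,1}, jointly independent of (σ_t). Given an arbitrary initial vector n(0) ∈ ℤ^N, define n : ℕ → ℤ^N by: if σ_t = {i, j}, then n_{t+1}(i) = n_{t+1}(j) = ⌈n_t(i)/2⌉ + ⌈n_t(j)/2⌉ − ξ_t^1·(n_t(i) mod 2) − ξ_t^2·(n_t(j)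 mod 2), while n_{t+1}(h) = n_t(h) for h ∉ {i, j}. Then almost surely there exists T ∈ ℕ such that for all t ≥ T, n(t) belongs to the set A = {y ∈ ℤ^N : ∃ α ∈ ℤ such that y_i = 2α for every i}. -/
open MeasureTheory

namespace QuantizedGossip

variable {V : Type*}

/-- All entries equal one even integer. -/
def EvenConsensus (x : V → ℤ) : Prop := ∃ α : ℤ, ∀ i, x i = 2 * α

/-- The update along the edge `e` when both quantizers round up. -/
def CeilStep (e : Sym2 V) (x y : V → ℤ) : Prop :=
  ∃ i j, i ≠ j ∧ e = s(i, j) ∧ y i = (x i + 1) / 2 + (x j + 1) / 2 ∧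
    y j = (x i + 1) / 2 + (x j + 1) / 2 ∧ ∀ h, h ≠ i → h ≠ j → y h = x h

/-- A weight that strictly decreases under every rounding-up update that changes the state. -/
def potential [Fintype V] (B : ℤ) (x : V → ℤ) : ℕ := ∑ i, 3 ^ (2 * B - x i).toNat

lemma ceil_half (a : ℤ) : ⌈(a : ℚ) / 2⌉ = (a + 1) / 2 := by
  rw [Int.ceil_eq_iff]
  have h1 : 2 * ((a + 1) / 2) - 2 < a := by omega
  have h2 : a ≤ 2 * ((a + 1) / 2) := by omega
  have h1' : (2 : ℚ) * ((a + 1) / 2 : ℤ) - 2 < a := by exact_mod_cast h1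
  have h2' : (a : ℚ) ≤ 2 * ((a + 1) / 2 : ℤ) := by exact_mod_cast h2
  constructor <;> linarith

lemma two_mul_three_pow_lt {B a b c : ℤ} (ha : a ≤ 2 * B) (hb : b ≤ 2 * B) (hab : a ≤ b)
    (hc : c = (a + 1) / 2 + (b + 1) / 2) (hne : ¬(a = b ∧ a % 2 = 0)) :
    3 ^ (2 * B - c).toNat + 3 ^ (2 * B - c).toNat <
      3 ^ (2 * B - a).toNat + 3 ^ (2 * B - b).toNat := by
  have hlt : (2 * B - c).toNat + 1 ≤ (2 * B - a).toNat := by omega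
  have hpow : 3 ^ ((2 * B - c).toNat + 1) ≤ 3 ^ (2 * B - a).toNat :=
    Nat.pow_le_pow_right (by norm_num) hlt
  rw [pow_succ] at hpow
  have : 0 < 3 ^ (2 * B - b).toNat := by positivity
  omega

lemma evenConsensus_of_adj {G : SimpleGraph V} (hG : G.Connected) {x : V → ℤ}
    (h : ∀ i j, G.Adj i j → x i = x j ∧ x i % 2 = 0) [Nontrivial V] : EvenConsensus x := by
  obtain ⟨v⟩ := hG.nonempty
  have hconst : ∀ i, x i = x v := by
    intro i
    obtain ⟨p⟩ := hG.preconnected i v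
    induction p with
    | nil => rfl
    | cons hadj _ ih => exact (h _ _ hadj).1.trans ih
  obtain ⟨w, hw⟩ := hG.preconnected.exists_adj_of_nontrivial v
  refine ⟨x v / 2, fun i => ?_⟩
  have := (h _ _ hw).2
  rw [hconst i]
  omega

variable [Fintype V] [DecidableEq V]

lemma potential_eq_add_sum (B : ℤ) (x : V → ℤ) {i j : V} (hij : i ≠ j) :
    potential B x = 3 ^ (2 * B - x i).toNat + 3 ^ (2 * B - x j).toNat +
      ∑ h ∈ (Finset.univ.erase i).erase j, 3 ^ (2 * B - x h).toNat := by
  unfold potential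
  rw [← Finset.add_sum_erase _ _ (Finset.mem_univ i),
    ← Finset.add_sum_erase (Finset.univ.erase i) _ (by simp [hij.symm] : j ∈ _), add_assoc]

/-- A rounding-up update decreases the potential unless its edge carries one even value. -/
lemma CeilStep.potential_lt_or {B : ℤ} {e : Sym2 V} {x y : V → ℤ} (h : CeilStep e x y)
    (hx : ∀ i, x i ≤ 2 * B) :
    potential B y < potential B x ∨
      (y = x ∧ ∀ i j, e = s(i, j) → x i = x j ∧ x i % 2 = 0) := by
  obtain ⟨i, j, hij, rfl, hi, hj, hrest⟩ := h
  by_cases hne : x i = x j ∧ x i % 2 = 0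
  · right
    obtain ⟨heq, hev⟩ := hne
    constructor
    · funext k
      by_cases hki : k = i
      · subst hki; omega
      by_cases hkj : k = j
      · subst hkj; omega
      exact hrest k hki hkj
    · intro a b hab
      rcases Sym2.eq_iff.1 hab with ⟨rfl, rfl⟩ | ⟨rfl, rfl⟩ <;> omega
  · left
    rw [potential_eq_add_sum B x hij, potential_eq_add_sum B y hij]
    have hsum : ∑ h ∈ (Finset.univ.erase i).erase j, 3 ^ (2 * B - y h).toNat =
        ∑ h ∈ (Finset.univ.erase i).erase j, 3 ^ (2 * B - x h).toNat := by
      refine Finset.sum_congr rfl fun k hk => ?_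
      simp only [Finset.mem_erase, Finset.mem_univ, and_true] at hk
      rw [hrest k hk.2 hk.1]
    rw [hsum, hi, hj]
    refine Nat.add_lt_add_right ?_ _
    rcases le_total (x i) (x j) with hle | hle
    · exact two_mul_three_pow_lt (hx i) (hx j) hle rfl hne
    · rw [add_comm (3 ^ (2 * B - x i).toNat)]
      exact two_mul_three_pow_lt (hx j) (hx i) hle (add_comm _ _) (by omega)

/-- A pass of rounding-up updates through all edges decreases the potential, unless it started
at an even consensus. -/
lemma potential_lt_or_of_pass [Nontrivial V] {G : SimpleGraph V} (hG : G.Connected) {B : ℤ}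
    {m : ℕ} {e : ℕ → Sym2 V} {x : ℕ → V → ℤ} (hx : ∀ s i, x s i ≤ 2 * B)
    (hstep : ∀ s < m, CeilStep (e s) (x s) (x (s + 1)))
    (hcover : ∀ d ∈ G.edgeSet, ∃ s < m, e s = d) :
    potential B (x m) < potential B (x 0) ∨ EvenConsensus (x 0) := by
  have key : ∀ k ≤ m, potential B (x k) < potential B (x 0) ∨
      (x k = x 0 ∧ ∀ s < k, ∀ i j, e s = s(i, j) → x 0 i = x 0 j ∧ x 0 i % 2 = 0) := by
    intro k
    induction k with
    | zero => exact fun _ => Or.inr ⟨rfl, fun s hs => absurd hs (Nat.not_lt_zero s)⟩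
    | succ k ih =>
      intro hk
      have hnext := (hstep k hk).potential_lt_or (hx k)
      rcases ih (by omega) with hlt | ⟨heq, hflat⟩
      · rcases hnext with hlt' | ⟨heq', -⟩
        · exact Or.inl (hlt'.trans hlt)
        · exact Or.inl (heq' ▸ hlt)
      · rw [heq] at hnext
        rcases hnext with hlt' | ⟨heq', hflat'⟩
        · exact Or.inl hlt'
        · refine Or.inr ⟨heq', fun s hs => ?_⟩
          rcases Nat.lt_succ_iff_lt_or_eq.1 hs with hs | rfl
          · exact hflat s hs
          · exact hflat'
  refine (key m le_rfl).imp_right fun ⟨_, hflat⟩ => evenConsensus_of_adj hG fun i j hij => ?_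
  obtain ⟨s, hs, hes⟩ := hcover s(i, j) hij
  exact hflat s hs i j hes

/-- Sufficiently many passes through all edges lead to an even consensus. -/
lemma evenConsensus_of_passes [Nontrivial V] {G : SimpleGraph V} (hG : G.Connected) {B : ℤ}
    {m K : ℕ} {e : ℕ → Sym2 V} {x : ℕ → V → ℤ} (hx : ∀ s i, x s i ≤ 2 * B)
    (hstep : ∀ s < m * K, CeilStep (e s) (x s) (x (s + 1)))
    (hcover : ∀ k, ∀ d ∈ G.edgeSet, ∃ s < m, e (m * k + s) = d)
    (hstay : ∀ s, EvenConsensus (x s) → EvenConsensus (x (s + 1)))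
    (hK : potential B (x 0) < K) : EvenConsensus (x (m * K)) := by
  have hstay' : ∀ s r, EvenConsensus (x s) → EvenConsensus (x (s + r)) := by
    intro s r hs
    induction r with
    | zero => exact hs
    | succ r ih => exact hstay _ ih
  have key : ∀ k ≤ K, potential B (x (m * k)) + k ≤ potential B (x 0) ∨
      EvenConsensus (x (m * k)) := by
    intro k
    induction k with
    | zero => exact fun _ => Or.inl le_rfl
    | succ k ih =>
      intro hk
      rcases ih (by omega) with hle | hA
      · have hpass := potential_lt_or_of_pass hG (B := B) (m := m)
          (e := fun s => e (m * k + s)) (x := fun s => x (m * k + s)) (fun s => hx _)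
          (fun s hs => hstep _ (by nlinarith)) (hcover k)
        rcases hpass with hlt | hA
        · left
          simp only [add_zero] at hlt
          rw [Nat.mul_succ]
          omega
        · exact Or.inr (hstay' _ m hA)
      · exact Or.inr (hstay' _ m hA)
  rcases key K le_rfl with h | h
  · omega
  · exact h

end QuantizedGossip

/-- In an i.i.d. sequence, given by its cylinder probabilities, a prescribed sequence of values
of positive probability is almost surely followed on infinitely many blocks `[qℓ, qℓ + ℓ)`. -/
lemma ae_frequently_block {Ω α : Type*} [MeasurableSpace Ω] (P : Measure Ω)
    [IsProbabilityMeasure P] (X : ℕ → Ω → α) (hmeas : ∀ t z, MeasurableSet {ω | X t ω = z})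
    (hiid : ∀ (s : Finset ℕ) (f : ℕ → α),
      P (⋂ t ∈ s, {ω | X t ω = f t}) = ∏ t ∈ s, P {ω | X 0 ω = f t})
    (ℓ : ℕ) (f : ℕ → α) (hper : ∀ q s, f (q * ℓ + s) = f s)
    (hpos : ∀ t, 0 < P {ω | X 0 ω = f t}) :
    ∀ᵐ ω ∂P, ∃ᶠ q in Filter.atTop, ∀ s < ℓ, X (q * ℓ + s) ω = f (q * ℓ + s) := by
  let block : ℕ → Finset ℕ := fun q => Finset.Ico (q * ℓ) (q * ℓ + ℓ)
  let E : ℕ → Set Ω := fun q => ⋂ t ∈ block q, {ω | X t ω = f t}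
  have hE : ∀ q, MeasurableSet (E q) := fun q =>
    Finset.measurableSet_biInter _ fun t _ => hmeas t _
  have hdisj : Pairwise fun q r => Disjoint (block q) (block r) := by
    have hlt : ∀ q r, q < r → Disjoint (block q) (block r) := by
      intro q r hqr
      rw [Finset.disjoint_left]
      intro t hq hr
      simp only [block, Finset.mem_Ico] at hq hr
      have : (q + 1) * ℓ ≤ r * ℓ := Nat.mul_le_mul_right _ hqr
      rw [Nat.succ_mul] at this
      omega
    intro q r hqr
    rcases lt_or_gt_of_ne hqr with h | h
    · exact hlt q r h
    · exact (hlt r q h).symm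
  have hind : ProbabilityTheory.iIndepSet E P := by
    rw [ProbabilityTheory.iIndepSet_iff_meas_biInter hE]
    intro S
    have hunion : ⋂ q ∈ S, E q = ⋂ t ∈ S.biUnion block, {ω | X t ω = f t} := by
      rw [Finset.set_biInter_biUnion]
    rw [hunion, hiid, Finset.prod_biUnion fun q _ r _ hqr => hdisj hqr]
    exact Finset.prod_congr rfl fun q _ => (hiid _ _).symm
  have hprob : ∀ q, P (E q) = ∏ s ∈ Finset.range ℓ, P {ω | X 0 ω = f s} := by
    intro q
    simp only [E, block, hiid, Finset.prod_Ico_eq_prod_range, Nat.add_sub_cancel_left, hper]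
  have hsum : ∑' q, P (E q) = ⊤ := by
    simp only [hprob]
    exact ENNReal.tsum_const_eq_top_of_ne_zero
      (Finset.prod_ne_zero_iff.2 fun s _ => (hpos s).ne')
  have hlim := ProbabilityTheory.measure_limsup_eq_one hE hind hsum
  have hae : ∀ᵐ ω ∂P, ω ∈ Filter.limsup E Filter.atTop :=
    (prob_compl_eq_zero_iff (MeasurableSet.measurableSet_limsup hE)).2 hlim
  filter_upwards [hae] with ω hω
  rw [Filter.mem_limsup_iff_frequently_mem] at hω
  refine hω.mono fun q hq s hs => ?_
  simp only [E, block, Set.mem_iInter, Finset.mem_Ico] at hq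
  exact hq (q * ℓ + s) ⟨by omega, by omega⟩

/-- Symbolic dynamics of the totally quantized gossip rule with probabilistic quantizer:
when edge {i,j} is selected, both entries become
`⌈nᵢ/2⌉ + ⌈nⱼ/2⌉ - ξ¹·(nᵢ mod 2) - ξ²·(nⱼ mod 2)` with independent fair coins ξ¹, ξ².
Almost surely the process enters (and stays in) `A = {y : ∃ α, ∀ i, y i = 2α}`
in finite time. -/
theorem stmt_4 {N : ℕ} (hN : 2 ≤ N) (G : SimpleGraph (Fin N)) (hG : G.Connected)
    {Ω : Type*} [MeasurableSpace Ω] (P : Measure Ω) [IsProbabilityMeasure P]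
    (σ : ℕ → Ω → Sym2 (Fin N)) (ξ1 ξ2 : ℕ → Ω → ℤ)
    (hrange : ∀ t ω, σ t ω ∈ G.edgeSet)
    (hval : ∀ t ω, (ξ1 t ω = 0 ∨ ξ1 t ω = 1) ∧ (ξ2 t ω = 0 ∨ ξ2 t ω = 1))
    (hmeas : ∀ (t : ℕ) (z : Sym2 (Fin N) × ℤ × ℤ),
      MeasurableSet {ω | (σ t ω, ξ1 t ω, ξ2 t ω) = z})
    (hiid : ∀ (s : Finset ℕ) (f : ℕ → Sym2 (Fin N) × ℤ × ℤ),
      P (⋂ t ∈ s, {ω | (σ t ω, ξ1 t ω, ξ2 t ω) = f t}) =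
        ∏ t ∈ s, P {ω | (σ 0 ω, ξ1 0 ω, ξ2 0 ω) = f t})
    (hdist : ∀ e ∈ G.edgeSet, ∀ b1 b2 : ℤ, (b1 = 0 ∨ b1 = 1) → (b2 = 0 ∨ b2 = 1) →
      P {ω | (σ 0 ω, ξ1 0 ω, ξ2 0 ω) = (e, b1, b2)} =
        P {ω | σ 0 ω = e} * (1/2) * (1/2))
    (hpos : ∀ e ∈ G.edgeSet, 0 < P {ω | σ 0 ω = e})
    (n0 : Fin N → ℤ) (n : ℕ → Ω → Fin N → ℤ)
    (h0 : ∀ ω, n 0 ω = n0)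
    (hupd : ∀ (t : ℕ) (ω : Ω), ∃ i j : Fin N, G.Adj i j ∧ σ t ω = s(i, j) ∧
      n (t+1) ω i = ⌈(n t ω i : ℚ) / 2⌉ + ⌈(n t ω j : ℚ) / 2⌉
        - ξ1 t ω * (n t ω i % 2) - ξ2 t ω * (n t ω j % 2) ∧
      n (t+1) ω j = ⌈(n t ω i : ℚ) / 2⌉ + ⌈(n t ω j : ℚ) / 2⌉
        - ξ1 t ω * (n t ω i % 2) - ξ2 t ω * (n t ω j % 2) ∧
      ∀ h : Fin N, h ≠ i → h ≠ j → n (t+1) ω h = n t ω h) :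
    ∀ᵐ ω ∂P, ∃ T : ℕ, ∀ t ≥ T, ∃ α : ℤ, ∀ i, n t ω i = 2 * α := by
  classical
  have : Nontrivial (Fin N) := Fin.nontrivial_iff_two_le.2 hN
  have hstep : ∀ t ω, ∃ i j : Fin N, i ≠ j ∧ σ t ω = s(i, j) ∧
      n (t + 1) ω i = (n t ω i + 1) / 2 + (n t ω j + 1) / 2
        - ξ1 t ω * (n t ω i % 2) - ξ2 t ω * (n t ω j % 2) ∧
      n (t + 1) ω j = (n t ω i + 1) / 2 + (n t ω j + 1) / 2
        - ξ1 t ω * (n t ω i % 2) - ξ2 t ω * (n t ω j % 2) ∧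
      ∀ h : Fin N, h ≠ i → h ≠ j → n (t + 1) ω h = n t ω h := by
    intro t ω
    obtain ⟨i, j, hadj, hσ, hi, hj, hrest⟩ := hupd t ω
    rw [QuantizedGossip.ceil_half, QuantizedGossip.ceil_half] at hi hj
    exact ⟨i, j, hadj.ne, hσ, hi, hj, hrest⟩
  obtain ⟨B, hB⟩ : ∃ B : ℤ, ∀ i, |n0 i| ≤ 2 * B :=
    ⟨∑ i, |n0 i|, fun i => by
      have h := Finset.single_le_sum (f := fun i => |n0 i|) (fun i _ => abs_nonneg _)
        (Finset.mem_univ i)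
      have h' := abs_nonneg (n0 i)
      omega⟩
  have hbound : ∀ ω t i, -(2 * B) ≤ n t ω i ∧ n t ω i ≤ 2 * B := by
    intro ω t
    induction t with
    | zero => exact fun i => by rw [h0]; exact abs_le.1 (hB i)
    | succ t ih =>
      obtain ⟨i, j, -, -, hi, hj, hrest⟩ := hstep t ω
      have hbi := ih i
      have hbj := ih j
      have hnew : -(2 * B) ≤ n (t + 1) ω i ∧ n (t + 1) ω i ≤ 2 * B := by
        rw [hi]
        rcases hval t ω with ⟨h1 | h1, h2 | h2⟩ <;> rw [h1, h2] <;> omega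
      intro k
      by_cases hki : k = i
      · exact hki ▸ hnew
      by_cases hkj : k = j
      · rw [hkj, hj, ← hi]
        exact hnew
      · rw [hrest k hki hkj]
        exact ih k
  have hstay : ∀ ω t, QuantizedGossip.EvenConsensus (n t ω) →
      QuantizedGossip.EvenConsensus (n (t + 1) ω) := by
    rintro ω t ⟨α, hα⟩
    obtain ⟨i, j, -, -, hi, hj, hrest⟩ := hstep t ω
    have hmod : 2 * α % 2 = 0 := by omega
    simp only [hα, hmod, mul_zero, sub_zero] at hi hj
    refine ⟨α, fun k => ?_⟩
    by_cases hki : k = i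
    · subst hki; omega
    by_cases hkj : k = j
    · subst hkj; omega
    · rw [hrest k hki hkj, hα]
  obtain ⟨ω₀⟩ : Nonempty Ω := nonempty_of_isProbabilityMeasure P
  let m := Fintype.card G.edgeSet
  have hm : 0 < m := Fintype.card_pos_iff.2 ⟨⟨_, hrange 0 ω₀⟩⟩
  let enum : Fin m ≃ G.edgeSet := (Fintype.equivFin G.edgeSet).symm
  let e : ℕ → Sym2 (Fin N) := fun t => enum ⟨t % m, Nat.mod_lt t hm⟩
  have he : ∀ t, e t ∈ G.edgeSet := fun t => (enum _).2
  have hper : ∀ k s, e (m * k + s) = e s := fun k s => by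
    simp only [e, Nat.mul_add_mod]
  have hcover : ∀ k, ∀ d ∈ G.edgeSet, ∃ s < m, e (m * k + s) = d := by
    intro k d hd
    refine ⟨enum.symm ⟨d, hd⟩, (enum.symm ⟨d, hd⟩).2, ?_⟩
    rw [hper]
    simp [e, Nat.mod_eq_of_lt]
  let K := N * 3 ^ (4 * B).toNat + 1
  have hpot : ∀ ω t, QuantizedGossip.potential B (n t ω) < K := by
    intro ω t
    refine Nat.lt_succ_of_le ?_
    calc QuantizedGossip.potential B (n t ω) ≤ ∑ _i : Fin N, 3 ^ (4 * B).toNat :=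
          Finset.sum_le_sum fun i _ => Nat.pow_le_pow_right (by norm_num) (by
            have := hbound ω t i
            omega)
      _ = N * 3 ^ (4 * B).toNat := by simp
  have hperK : ∀ q s, e (q * (m * K) + s) = e s := fun q s => by
    rw [show q * (m * K) + s = m * (q * K) + s by ring, hper]
  have hfreq := ae_frequently_block P (fun t ω => (σ t ω, ξ1 t ω, ξ2 t ω)) hmeas hiid (m * K)
    (fun t => (e t, 0, 0)) (fun q s => by simp only [hperK]) (fun t => by
      rw [hdist _ (he t) 0 0 (Or.inl rfl) (Or.inl rfl)]
      have := (hpos _ (he t)).ne'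
      exact pos_iff_ne_zero.2 (by simp [this]))
  filter_upwards [hfreq] with ω hω
  obtain ⟨q, hq⟩ := hω.exists
  have hA := QuantizedGossip.evenConsensus_of_passes hG (B := B) (m := m) (K := K) (e := e)
    (x := fun s => n (q * (m * K) + s) ω) (fun s i => (hbound ω _ i).2) (fun s hs => by
      have hs' := hq s hs
      simp only [Prod.mk.injEq, hperK] at hs'
      obtain ⟨hσ, h1, h2⟩ := hs'
      obtain ⟨i, j, hij, hσ', hi, hj, hrest⟩ := hstep (q * (m * K) + s) ω
      simp only [h1, h2, zero_mul, sub_zero] at hi hj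
      exact ⟨i, j, hij, hσ.symm.trans hσ', hi, hj, hrest⟩)
    hcover (fun s => hstay ω _) (hpot ω _)
  refine ⟨q * (m * K) + m * K, fun t ht => ?_⟩
  induction t, ht using Nat.le_induction with
  | base => exact hA
  | succ t _ ih => exact hstay ω t ih
end

section
/- Let N ≥ 2, let G be a connected simple graph on the vertex set Fin N. On a probability space (Ω, P), let (σ_t)_{t∈ℕ} be an i.i.d. sequence of edge-valued random variables with P(σ_t = e) > 0 for every edge e of G, and let (U_t)_{t∈ℕ} be an i.i.d. sequence of random vectors uniformly distributed on [0,1)^N, jointly independent of (σ_t). Define the probabilistic quantizer as q_p(z, u) = ⌊z⌋ + 1 if u < z − ⌊z⌋, and q_p(z, u) = ⌊z⌋ otherwise. Given x(0) ∈ ℝ^N, define x : ℕ → ℝ^N by: if σ_t = {i, j}, then x_{t+1}(i) = x_{t+1}(j) = (1/2)q_p(x_t(i), U_t(i)) + (1/2)q_p(x_t(j), U_t(j)), while x_{t+1}(h) = x_t(h) for h ∉ {i, j}. Then almost surely there exist T ∈ ℕ and an integer α ∈ ℤ such that x_i(t) = α for every i ∈ Fin N and every t ≥ T. -/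
open MeasureTheory

/-- The probabilistic quantizer realized via a uniform `[0,1)` variable:
`qp z u = ⌊z⌋ + 1` if `u < Int.fract z`, else `⌊z⌋`. -/
noncomputable def qp (z u : ℝ) : ℤ :=
  if u < Int.fract z then ⌊z⌋ + 1 else ⌊z⌋

/-- The uniform probability distribution on the cube `[0,1)^N`. -/
noncomputable def unifCube (N : ℕ) : Measure (Fin N → ℝ) :=
  Measure.pi fun _ => (volume.restrict (Set.Ico (0:ℝ) 1))

section Quantizer

lemma floor_le_qp (z u : ℝ) : ⌊z⌋ ≤ qp z u := by
  unfold qp; split_ifs <;> omega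

lemma qp_le_ceil {z u : ℝ} (hu : 0 ≤ u) : qp z u ≤ ⌈z⌉ := by
  unfold qp
  split_ifs with h
  · have hz : (⌊z⌋ : ℝ) < z := by
      have := Int.self_sub_floor z
      linarith
    have := Int.lt_ceil.2 hz
    omega
  · exact Int.floor_le_ceil z

lemma qp_intCast {u : ℝ} (hu : 0 ≤ u) (a : ℤ) : qp a u = a := by
  simp [qp, not_lt.2 hu]

lemma qp_eq_ceil {z u δ : ℝ} (hu : 0 ≤ u) (huδ : u < δ)
    (hz : Int.fract z = 0 ∨ δ ≤ Int.fract z) : qp z u = ⌈z⌉ := by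
  rcases hz with hz | hz
  · obtain ⟨a, rfl⟩ := Int.fract_eq_zero_iff.1 hz
    rw [qp_intCast hu, Int.ceil_intCast]
  · have h : u < Int.fract z := huδ.trans_le hz
    refine le_antisymm (qp_le_ceil hu) ?_
    rw [qp, if_pos h]
    exact Int.ceil_le_floor_add_one z

lemma fract_half_add_half (a b : ℤ) :
    Int.fract ((1/2) * (a : ℝ) + (1/2) * (b : ℝ)) = 0 ∨
      Int.fract ((1/2) * (a : ℝ) + (1/2) * (b : ℝ)) = 1/2 := by
  have hab : (1/2) * (a : ℝ) + (1/2) * (b : ℝ) = ((a + b : ℤ) : ℝ) / 2 := by push_cast; ring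
  rw [hab]
  rcases Int.even_or_odd' (a + b) with ⟨c, h | h⟩
  · left; rw [h]; push_cast
    rw [mul_div_cancel_left₀ _ two_ne_zero, Int.fract_intCast]
  · right; rw [h]; push_cast
    rw [show (2 * (c : ℝ) + 1) / 2 = c + 1/2 by ring, Int.fract_intCast_add,
      Int.fract_eq_self.2 (by norm_num)]

lemma ceil_half_add_half (a b : ℤ) :
    a + b ≤ 2 * ⌈(1/2) * (a : ℝ) + (1/2) * (b : ℝ)⌉ ∧
      2 * ⌈(1/2) * (a : ℝ) + (1/2) * (b : ℝ)⌉ ≤ a + b + 1 := by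
  have h₁ := Int.le_ceil ((1/2) * (a : ℝ) + (1/2) * (b : ℝ))
  have h₂ := Int.ceil_lt_add_one ((1/2) * (a : ℝ) + (1/2) * (b : ℝ))
  generalize ⌈(1/2) * (a : ℝ) + (1/2) * (b : ℝ)⌉ = c at *
  constructor
  · have : ((a + b : ℤ) : ℝ) ≤ ((2 * c : ℤ) : ℝ) := by push_cast; linarith
    exact_mod_cast this
  · have : ((2 * c : ℤ) : ℝ) < ((a + b + 2 : ℤ) : ℝ) := by push_cast; linarith
    have : 2 * c < a + b + 2 := by exact_mod_cast this
    omega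

end Quantizer

section CeilingDynamics

variable {V : Type*}

/-- The second integer state arises from the first one when the endpoints of the edge `e`
both replace their value by the ceiling of the average. -/
def IsCeilStep (e : Sym2 V) (y y' : V → ℤ) : Prop :=
  ∀ i j, e = s(i, j) →
    (y i + y j ≤ 2 * y' i ∧ 2 * y' i ≤ y i + y j + 1) ∧ ∀ h, h ≠ i → h ≠ j → y' h = y h

lemma IsCeilStep.apply_right {e : Sym2 V} {y y' : V → ℤ} (hs : IsCeilStep e y y') {i j : V}
    (he : e = s(i, j)) : y' j = y' i := by
  have h₁ := (hs i j he).1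
  have h₂ := (hs j i (he.trans Sym2.eq_swap)).1
  omega

lemma IsCeilStep.eq_of_eq {e : Sym2 V} {y y' : V → ℤ} (hs : IsCeilStep e y y') {i j : V}
    (he : e = s(i, j)) (hij : y i = y j) : y' = y := by
  have h₁ := (hs i j he).1
  have h₂ := hs.apply_right he
  funext h
  by_cases hi : h = i
  · subst hi; omega
  by_cases hj : h = j
  · subst hj; omega
  exact (hs i j he).2 h hi hj

lemma IsCeilStep.const {e : Sym2 V} {y y' : V → ℤ} (hs : IsCeilStep e y y') {a : ℤ}
    (ha : ∀ i, y i = a) : ∀ i, y' i = a := by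
  induction e using Sym2.ind with
  | _ i j => rwa [hs.eq_of_eq rfl ((ha i).trans (ha j).symm)]

variable [Fintype V]

/-- Exponentially weighted distance of an integer state to the upper bound `M`. -/
def ceilPotential (M : ℤ) (y : V → ℤ) : ℕ := ∑ i, 2 ^ (M - y i).toNat

lemma IsCeilStep.potential_lt {e : Sym2 V} {y y' : V → ℤ} (hs : IsCeilStep e y y') {M : ℤ}
    (hM : ∀ i, y i ≤ M) {i j : V} (he : e = s(i, j)) (hij : y i < y j) :
    ceilPotential M y' < ceilPotential M y := by
  classical
  have hne : i ≠ j := by rintro rfl; exact hij.false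
  have hji : j ∈ Finset.univ.erase i := by simp [hne.symm]
  have h₁ := (hs i j he).1
  have h₂ := hs.apply_right he
  have hMj := hM j
  unfold ceilPotential
  rw [← Finset.add_sum_erase _ _ (Finset.mem_univ i), ← Finset.add_sum_erase _ _ hji,
    ← Finset.add_sum_erase _ (fun i => 2 ^ (M - y i).toNat) (Finset.mem_univ i),
    ← Finset.add_sum_erase _ (fun i => 2 ^ (M - y i).toNat) hji]
  have hrest : ∑ k ∈ (Finset.univ.erase i).erase j, 2 ^ (M - y' k).toNat =
      ∑ k ∈ (Finset.univ.erase i).erase j, 2 ^ (M - y k).toNat := by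
    refine Finset.sum_congr rfl fun k hk => ?_
    simp only [Finset.mem_erase, Finset.mem_univ, and_true] at hk
    rw [(hs i j he).2 k hk.2 hk.1]
  have hle : 2 ^ ((M - y' i).toNat + 1) ≤ 2 ^ (M - y i).toNat :=
    Nat.pow_le_pow_right two_pos (by omega)
  have hpos : 0 < 2 ^ (M - y j).toNat := by positivity
  rw [hrest, h₂]
  rw [pow_succ] at hle
  omega

lemma IsCeilStep.potential_lt_or {e : Sym2 V} {y y' : V → ℤ} (hs : IsCeilStep e y y') {M : ℤ}
    (hM : ∀ i, y i ≤ M) :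
    ceilPotential M y' < ceilPotential M y ∨ (y' = y ∧ ∀ i j, e = s(i, j) → y i = y j) := by
  by_cases h : ∀ i j, e = s(i, j) → y i = y j
  · right
    refine ⟨?_, h⟩
    induction e using Sym2.ind with
    | _ i j => exact hs.eq_of_eq rfl (h i j rfl)
  · left
    push Not at h
    obtain ⟨i, j, he, hij⟩ := h
    rcases hij.lt_or_gt with hij | hij
    · exact hs.potential_lt hM he hij
    · exact hs.potential_lt hM (he.trans Sym2.eq_swap) hij

/-- A sweep through all edges of a connected graph lowers the potential unless the state is
constant. -/
lemma potential_lt_or_const_of_sweep {G : SimpleGraph V} (hG : G.Connected) {n : ℕ}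
    {w : ℕ → Sym2 V} (hw : ∀ e ∈ G.edgeSet, ∃ r < n, w r = e) {M : ℤ} {y : ℕ → V → ℤ}
    (hM : ∀ t i, y t i ≤ M) (hs : ∀ t < n, IsCeilStep (w t) (y t) (y (t + 1))) :
    ceilPotential M (y n) < ceilPotential M (y 0) ∨ ∃ a, ∀ i, y n i = a := by
  have key : ∀ k ≤ n, ceilPotential M (y k) < ceilPotential M (y 0) ∨
      (y k = y 0 ∧ ∀ r < k, ∀ i j, w r = s(i, j) → y 0 i = y 0 j) := by
    intro k
    induction k with
    | zero => simp
    | succ k ih =>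
      intro hk
      have hstep := (hs k hk).potential_lt_or (hM k)
      rcases ih (by omega) with h | ⟨h, h'⟩
      · left
        rcases hstep with h₂ | ⟨h₂, -⟩
        · exact h₂.trans h
        · rwa [h₂]
      · rw [h] at hstep
        rcases hstep with h₂ | ⟨h₂, h₃⟩
        · exact .inl h₂
        · refine .inr ⟨h₂, fun r hr => ?_⟩
          rcases Nat.lt_succ_iff_lt_or_eq.1 hr with hr | rfl
          · exact h' r hr
          · exact h₃
  refine (key n le_rfl).imp id fun ⟨h, h'⟩ => ?_
  have hadj : ∀ i j, G.Adj i j → y 0 i = y 0 j := fun i j hij => by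
    obtain ⟨r, hr, hre⟩ := hw s(i, j) hij
    exact h' r hr i j hre
  obtain ⟨i₀⟩ := hG.nonempty
  refine ⟨y 0 i₀, fun i => ?_⟩
  rw [h]
  obtain ⟨p⟩ := hG.preconnected i i₀
  induction p with
  | nil => rfl
  | cons hij _ ih => exact (hadj _ _ hij).trans ih

lemma const_of_sweeps {G : SimpleGraph V} (hG : G.Connected) {n K : ℕ}
    {w : ℕ → Sym2 V} (hw : ∀ e ∈ G.edgeSet, ∀ k, ∃ r < n, w (k * n + r) = e) {M : ℤ}
    {y : ℕ → V → ℤ} (hM : ∀ t i, y t i ≤ M)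
    (hs : ∀ t < K * n, IsCeilStep (w t) (y t) (y (t + 1)))
    (hK : ceilPotential M (y 0) < K) : ∃ a, ∀ i, y (K * n) i = a := by
  have key : ∀ k ≤ K, ceilPotential M (y (k * n)) + k ≤ ceilPotential M (y 0) ∨
      ∃ a, ∀ i, y (k * n) i = a := by
    intro k
    induction k with
    | zero => simp
    | succ k ih =>
      intro hk
      have hlt : ∀ r < n, k * n + r < K * n := fun r hr => by
        have := Nat.mul_le_mul_right n hk
        rw [Nat.succ_mul] at this
        omega
      rw [Nat.succ_mul]
      rcases ih (by omega) with h | ⟨a, ha⟩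
      · refine (potential_lt_or_const_of_sweep hG (w := fun r => w (k * n + r))
          (y := fun r => y (k * n + r)) (fun e he => hw e he k) (fun t => hM _)
          (fun r hr => hs _ (hlt r hr))).imp (fun h₂ => ?_) id
        simp only [add_zero] at h₂
        omega
      · right
        refine ⟨a, ?_⟩
        have : ∀ r ≤ n, ∀ i, y (k * n + r) i = a := by
          intro r
          induction r with
          | zero => intro _; simpa using ha
          | succ r ihr => exact fun hr => (hs _ (hlt r hr)).const (ihr (by omega))
        exact this n le_rfl
  rcases key K le_rfl with h | h
  · omega
  · exact h

lemma ceilPotential_le {M m : ℤ} {y : V → ℤ} (hm : ∀ i, m ≤ y i) :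
    ceilPotential M y ≤ Fintype.card V * 2 ^ (M - m).toNat := by
  unfold ceilPotential
  refine (Finset.sum_le_card_nsmul _ _ (2 ^ (M - m).toNat) fun i _ => ?_).trans_eq (by simp)
  have := hm i
  exact Nat.pow_le_pow_right two_pos (by omega)

end CeilingDynamics

section RealDynamics

variable {V : Type*}

/-- If the rounded-up gossip dynamics runs through sufficiently many sweeps of a connected graph,
then it ends at an integer consensus. -/
lemma consensus_of_ceil_sweeps [Fintype V] [Nontrivial V] {G : SimpleGraph V} (hG : G.Connected)
    {n K : ℕ} {w : ℕ → Sym2 V} (hwG : ∀ t, w t ∈ G.edgeSet)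
    (hw : ∀ e ∈ G.edgeSet, ∀ k, ∃ r < n, w (k * n + r) = e) {m M : ℤ}
    {v : ℕ → V → ℝ} (hm : ∀ t i, (m : ℝ) ≤ v t i) (hM : ∀ t i, v t i ≤ M)
    (hs : ∀ t < (K + 1) * n, ∀ i j, G.Adj i j → w t = s(i, j) →
      v (t + 1) i = (1/2) * (⌈v t i⌉ : ℝ) + (1/2) * (⌈v t j⌉ : ℝ) ∧
        ∀ h, h ≠ i → h ≠ j → v (t + 1) h = v t h)
    (hK : Fintype.card V * 2 ^ (M - m).toNat < K) :
    ∃ a : ℤ, ∀ i, v ((K + 1) * n) i = a := by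
  have hceil : ∀ t < (K + 1) * n,
      IsCeilStep (w t) (fun i => ⌈v t i⌉) (fun i => ⌈v (t + 1) i⌉) := by
    intro t ht i j he
    have hij : G.Adj i j := by rw [← SimpleGraph.mem_edgeSet, ← he]; exact hwG t
    obtain ⟨h₁, h₂⟩ := hs t ht i j hij he
    refine ⟨?_, fun h hi hj => by simp only [h₂ h hi hj]⟩
    simp only [h₁]
    exact ceil_half_add_half _ _
  have hsucc : (K + 1) * n = K * n + n := by ring
  obtain ⟨a, ha⟩ := const_of_sweeps hG (K := K) hw (y := fun t i => ⌈v t i⌉) (M := M)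
    (fun t i => Int.ceil_le.2 (hM t i)) (fun t ht => hceil t (by omega))
    ((ceilPotential_le fun i => by
      have := (hm 0 i).trans (Int.le_ceil _)
      exact_mod_cast this).trans_lt hK)
  have hconst : ∀ r ≤ n, ∀ i, ⌈v (K * n + r) i⌉ = a := by
    intro r
    induction r with
    | zero => intro _; simpa using ha
    | succ r ih => exact fun hr => (hceil (K * n + r) (by omega)).const (ih (by omega))
  have hstep : ∀ r < n, ∀ i j, G.Adj i j → w (K * n + r) = s(i, j) →
      v (K * n + r + 1) i = a := by
    intro r hr i j hij he
    rw [(hs (K * n + r) (by omega) i j hij he).1, hconst r hr.le, hconst r hr.le]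
    ring
  refine ⟨a, fun i => ?_⟩
  obtain ⟨j, hij⟩ := hG.preconnected.exists_adj_of_nontrivial i
  obtain ⟨r₀, hr₀, hre⟩ := hw s(i, j) hij K
  have hstay : ∀ r, r₀ < r → r ≤ n → v (K * n + r) i = a := by
    intro r hr
    induction r, hr using Nat.le_induction with
    | base => exact fun _ => hstep r₀ hr₀ i j hij hre
    | succ r hr ih =>
      intro hrn
      have hwr := hwG (K * n + r)
      generalize hwe : w (K * n + r) = e at hwr
      induction e using Sym2.ind with
      | _ k l =>
        have hkl : G.Adj k l := hwr
        by_cases hk : i = k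
        · subst hk; exact hstep r hrn i l hkl hwe
        by_cases hl : i = l
        · subst hl; exact hstep r hrn i k hkl.symm (hwe.trans Sym2.eq_swap)
        exact ((hs (K * n + r) (by omega) k l hkl hwe).2 i hk hl).trans (ih (by omega))
  rw [hsucc]
  exact hstay n hr₀ le_rfl

/-- A periodic enumeration of a nonempty finite set. -/
lemma exists_periodic_enumeration {α : Type*} {S : Set α} (hS : S.Finite) (hne : S.Nonempty) :
    ∃ (n : ℕ) (w : ℕ → α), 0 < n ∧ (∀ t, w t ∈ S) ∧ (∀ k t, w (k * n + t) = w t) ∧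
      ∀ e ∈ S, ∃ r < n, w r = e := by
  have := hS.to_subtype
  have := hne.to_subtype
  obtain ⟨n, ⟨f⟩⟩ := Finite.exists_equiv_fin S
  have hn : 0 < n := (f (Classical.arbitrary S)).pos
  refine ⟨n, fun t => f.symm ⟨t % n, Nat.mod_lt _ hn⟩, hn, fun t => Subtype.coe_prop _,
    fun k t => by simp, fun e he => ⟨f ⟨e, he⟩, (f ⟨e, he⟩).2, ?_⟩⟩
  have : (⟨(f ⟨e, he⟩ : ℕ) % n, Nat.mod_lt _ hn⟩ : Fin n) = f ⟨e, he⟩ :=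
    Fin.ext (Nat.mod_eq_of_lt (f ⟨e, he⟩).2)
  simp [this]

lemma exists_fract_gap [Finite V] [Nonempty V] (v : V → ℝ) :
    ∃ δ : ℝ, 0 < δ ∧ δ ≤ 1/2 ∧ ∀ i, Int.fract (v i) = 0 ∨ δ ≤ Int.fract (v i) := by
  obtain ⟨i₀, h₀⟩ := Finite.exists_min
    fun i => if Int.fract (v i) = 0 then (1/2 : ℝ) else min (1/2) (Int.fract (v i))
  refine ⟨_, ?_, ?_, fun i => or_iff_not_imp_left.2 fun hi => (h₀ i).trans ?_⟩
  · split_ifs with h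
    · norm_num
    · exact lt_min (by norm_num) ((Int.fract_nonneg _).lt_of_ne' h)
  · split_ifs with h
    · exact le_rfl
    · exact min_le_left _ _
  · rw [if_neg hi]
    exact min_le_right _ _

end RealDynamics

section Probability

open ProbabilityTheory Filter
open scoped ENNReal

variable {Ω : Type*} [MeasurableSpace Ω] {P : Measure Ω} [IsProbabilityMeasure P]

/-- If independent events have probabilities bounded below by a positive constant, then almost surely
all events of some block of length `L` occur. -/
lemma ae_exists_block {D : ℕ → Set Ω} (hD : ∀ t, MeasurableSet (D t)) (hind : iIndepSet D P)
    {q : ℝ≥0∞} (hq : q ≠ 0) (hle : ∀ t, q ≤ P (D t)) (L : ℕ) :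
    ∀ᵐ ω ∂P, ∃ k, ∀ r < L, ω ∈ D (k * L + r) := by
  have hdisj : Pairwise fun k l : ℕ =>
      Disjoint (Finset.Ico (k * L) ((k + 1) * L)) (Finset.Ico (l * L) ((l + 1) * L)) := by
    have aux : ∀ k l : ℕ, k < l →
        Disjoint (Finset.Ico (k * L) ((k + 1) * L)) (Finset.Ico (l * L) ((l + 1) * L)) :=
      fun k l hkl => Finset.Ico_disjoint_Ico_consecutive _ _ _ |>.mono_right
        (Finset.Ico_subset_Ico_left (Nat.mul_le_mul_right L hkl))
    intro k l hkl
    rcases hkl.lt_or_gt with h | h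
    · exact aux k l h
    · exact (aux l k h).symm
  set A : ℕ → Set Ω := fun k => ⋂ t ∈ Finset.Ico (k * L) ((k + 1) * L), D t with hA
  have hAm : ∀ k, MeasurableSet (A k) := fun k =>
    Finset.measurableSet_biInter _ fun t _ => hD t
  have hAP : ∀ k, P (A k) = ∏ t ∈ Finset.Ico (k * L) ((k + 1) * L), P (D t) := fun k =>
    hind.meas_biInter _
  have hAind : iIndepSet A P := by
    rw [iIndepSet_iff_meas_biInter hAm]
    intro s
    have hU : (⋂ k ∈ s, A k) =
        ⋂ t ∈ s.biUnion fun k => Finset.Ico (k * L) ((k + 1) * L), D t := by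
      rw [Finset.set_biInter_biUnion]
    rw [hU, hind.meas_biInter, Finset.prod_biUnion fun k _ l _ hkl => hdisj hkl]
    exact Finset.prod_congr rfl fun k _ => (hAP k).symm
  have hlow : ∀ k, q ^ L ≤ P (A k) := fun k => by
    rw [hAP]
    refine le_trans ?_ (Finset.prod_le_prod' fun t _ => hle t)
    rw [Finset.prod_const, Nat.card_Ico, Nat.succ_mul, Nat.add_sub_cancel_left]
  have hsum : ∑' k, P (A k) = ∞ := by
    refine top_unique (le_trans ?_ (ENNReal.tsum_le_tsum hlow))
    rw [ENNReal.tsum_const_eq_top_of_ne_zero (pow_ne_zero _ hq)]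
  have hlim := measure_limsup_eq_one hAm hAind hsum
  have hae : ∀ᵐ ω ∂P, ω ∈ limsup A atTop :=
    mem_ae_iff_prob_eq_one (MeasurableSet.measurableSet_limsup hAm) |>.2 hlim
  filter_upwards [hae] with ω hω
  obtain ⟨k, hk⟩ := (Filter.mem_limsup_iff_frequently_mem.1 hω).exists
  refine ⟨k, fun r hr => ?_⟩
  simp only [hA, Set.mem_iInter, Finset.mem_Ico] at hk
  exact hk _ ⟨by omega, by rw [Nat.succ_mul]; omega⟩

lemma unifCube_pi_Ico {N : ℕ} {δ : ℝ} (hδ : δ ≤ 1) :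
    unifCube N (Set.univ.pi fun _ => Set.Ico 0 δ) = ENNReal.ofReal δ ^ N := by
  have : Set.Ico 0 δ ∩ Set.Ico (0:ℝ) 1 = Set.Ico 0 δ :=
    Set.inter_eq_left.2 (Set.Ico_subset_Ico_right hδ)
  simp [unifCube, Measure.pi_pi, Measure.restrict_apply measurableSet_Ico, this]

lemma unifCube_exists_neg (N : ℕ) : unifCube N {u | ∃ i, u i < 0} = 0 := by
  have : {u : Fin N → ℝ | ∃ i, u i < 0} = ⋃ i, Function.eval i ⁻¹' Set.Iio 0 := by
    ext; simp
  rw [this]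
  refine measure_iUnion_null fun i => Measure.pi_eval_preimage_null _ ?_
  rw [Measure.restrict_apply measurableSet_Iio]
  convert measure_empty (μ := volume)
  ext z
  simp only [Set.mem_inter_iff, Set.mem_Iio, Set.mem_Ico, Set.mem_empty_iff_false, iff_false]
  intro h
  linarith [h.1, h.2.1]

end Probability

/-- Totally quantized gossip algorithm with probabilistic quantizer:
almost surely the states reach consensus at an integer value in finite time. -/
theorem stmt_5 {N : ℕ} (hN : 2 ≤ N) (G : SimpleGraph (Fin N)) (hG : G.Connected)
    {Ω : Type*} [MeasurableSpace Ω] (P : Measure Ω) [IsProbabilityMeasure P]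
    (σ : ℕ → Ω → Sym2 (Fin N)) (U : ℕ → Ω → Fin N → ℝ)
    (hrange : ∀ t ω, σ t ω ∈ G.edgeSet)
    (hmeasσ : ∀ (t : ℕ) (e : Sym2 (Fin N)), MeasurableSet {ω | σ t ω = e})
    (hmeasU : ∀ t : ℕ, Measurable (U t))
    (hiid : ∀ (s : Finset ℕ) (f : ℕ → Sym2 (Fin N)) (B : ℕ → Set (Fin N → ℝ)),
      (∀ t, MeasurableSet (B t)) →
      P (⋂ t ∈ s, ({ω | σ t ω = f t} ∩ {ω | U t ω ∈ B t})) =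
        ∏ t ∈ s, (P {ω | σ 0 ω = f t} * unifCube N (B t)))
    (hpos : ∀ e ∈ G.edgeSet, 0 < P {ω | σ 0 ω = e})
    (x0 : Fin N → ℝ) (x : ℕ → Ω → Fin N → ℝ)
    (h0 : ∀ ω, x 0 ω = x0)
    (hupd : ∀ (t : ℕ) (ω : Ω) (i j : Fin N), G.Adj i j → σ t ω = s(i, j) →
      x (t+1) ω i = (1/2) * ((qp (x t ω i) (U t ω i) : ℤ) : ℝ)
        + (1/2) * ((qp (x t ω j) (U t ω j) : ℤ) : ℝ) ∧
      ∀ h : Fin N, h ≠ i → h ≠ j → x (t+1) ω h = x t ω h) :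
    ∀ᵐ ω ∂P, ∃ T : ℕ, ∃ α : ℤ, ∀ i, ∀ t ≥ T, x t ω i = (α : ℝ) := by
  have : Nontrivial (Fin N) := Fin.nontrivial_iff_two_le.2 hN
  obtain ⟨δ, hδ0, hδ2, hδ⟩ := exists_fract_gap x0
  have hne : G.edgeSet.Nonempty := by
    obtain ⟨i⟩ := hG.nonempty
    obtain ⟨j, hij⟩ := hG.preconnected.exists_adj_of_nontrivial i
    exact ⟨s(i, j), hij⟩
  obtain ⟨n, w, hn, hwG, hwper, hw⟩ := exists_periodic_enumeration (Set.toFinite G.edgeSet) hne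
  obtain ⟨imax, hmax⟩ := Finite.exists_max x0
  obtain ⟨imin, hmin⟩ := Finite.exists_min x0
  set M : ℤ := ⌈x0 imax⌉
  set m : ℤ := ⌊x0 imin⌋
  set K : ℕ := Fintype.card (Fin N) * 2 ^ (M - m).toNat + 1
  set box : Set (Fin N → ℝ) := Set.univ.pi fun _ => Set.Ico 0 δ
  have hbox : MeasurableSet box := MeasurableSet.univ_pi fun _ => measurableSet_Ico
  -- the controlled events: the prescribed edge is chosen and every quantizer rounds up
  set D : ℕ → Set Ω := fun t => {ω | σ t ω = w t} ∩ {ω | U t ω ∈ box} with hDdef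
  have hDm : ∀ t, MeasurableSet (D t) := fun t => (hmeasσ t _).inter (hmeasU t hbox)
  have hDinter : ∀ s : Finset ℕ, P (⋂ t ∈ s, D t) =
      ∏ t ∈ s, (P {ω | σ 0 ω = w t} * unifCube N box) :=
    fun s => hiid s w (fun _ => box) fun _ => hbox
  have hDP : ∀ t, P (D t) = P {ω | σ 0 ω = w t} * unifCube N box := fun t => by
    simpa using hDinter {t}
  have hDind : ProbabilityTheory.iIndepSet D P := by
    rw [ProbabilityTheory.iIndepSet_iff_meas_biInter hDm]
    intro s
    rw [hDinter]
    exact Finset.prod_congr rfl fun t _ => (hDP t).symm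
  obtain ⟨e₀, he₀, hmin₀⟩ :=
    Set.exists_min_image G.edgeSet (fun e => P {ω | σ 0 ω = e}) (Set.toFinite _) hne
  have hblock := ae_exists_block hDm hDind (q := P {ω | σ 0 ω = e₀} * unifCube N box)
    (by
      refine mul_ne_zero (hpos e₀ he₀).ne' ?_
      rw [unifCube_pi_Ico (by linarith)]
      exact pow_ne_zero _ (by simpa using hδ0))
    (fun t => by rw [hDP]; exact mul_le_mul_left (hmin₀ _ (hwG t)) _) ((K + 1) * n)
  have hnonneg : ∀ᵐ ω ∂P, ∀ t i, 0 ≤ U t ω i := by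
    rw [ae_all_iff]
    intro t
    have hmeas : MeasurableSet {u : Fin N → ℝ | ∃ i, u i < 0} := by
      have : {u : Fin N → ℝ | ∃ i, u i < 0} = ⋃ i, {u | u i < 0} := by ext; simp
      rw [this]
      exact MeasurableSet.iUnion fun i => measurableSet_lt (measurable_pi_apply i) measurable_const
    refine measure_mono_null (t := ⋃ e, {ω | σ t ω = e} ∩ {ω | U t ω ∈ {u | ∃ i, u i < 0}})
      (fun ω hω => ?_) (measure_iUnion_null fun e => ?_)
    · simpa using hω
    · simpa [unifCube_exists_neg] using
        hiid {t} (fun _ => e) (fun _ => {u | ∃ i, u i < 0}) fun _ => hmeas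
  filter_upwards [hblock, hnonneg] with ω ⟨k, hk⟩ hU
  have hcase : ∀ t, ∀ h, x (t + 1) ω h = x t ω h ∨ ∃ i j, x (t + 1) ω h =
      (1/2) * (qp (x t ω i) (U t ω i) : ℝ) + (1/2) * (qp (x t ω j) (U t ω j) : ℝ) := by
    intro t h
    have hr := hrange t ω
    generalize he : σ t ω = e at hr
    induction e using Sym2.ind with
    | _ i j =>
      have hij : G.Adj i j := hr
      by_cases hi : h = i
      · subst hi; exact .inr ⟨_, _, (hupd t ω h j hij he).1⟩
      by_cases hj : h = j
      · subst hj; exact .inr ⟨_, _, (hupd t ω h i hij.symm (he.trans Sym2.eq_swap)).1⟩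
      exact .inl ((hupd t ω i j hij he).2 h hi hj)
  have hbound : ∀ t i, (m : ℝ) ≤ x t ω i ∧ x t ω i ≤ M := by
    intro t
    induction t with
    | zero =>
      intro i
      rw [h0]
      exact ⟨(Int.floor_le _).trans (hmin i), (hmax i).trans (Int.le_ceil _)⟩
    | succ t ih =>
      have hq : ∀ i, (m : ℝ) ≤ qp (x t ω i) (U t ω i) ∧ (qp (x t ω i) (U t ω i) : ℝ) ≤ M :=
        fun i => ⟨by exact_mod_cast (Int.le_floor.2 (ih i).1).trans (floor_le_qp _ _),
          by exact_mod_cast (qp_le_ceil (hU t i)).trans (Int.ceil_le.2 (ih i).2)⟩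
      intro h
      rcases hcase t h with he | ⟨i, j, he⟩
      · rw [he]; exact ih h
      · rw [he]
        constructor <;> linarith [(hq i).1, (hq i).2, (hq j).1, (hq j).2]
  have hfract : ∀ t i, Int.fract (x t ω i) = 0 ∨ δ ≤ Int.fract (x t ω i) := by
    intro t
    induction t with
    | zero => rw [h0]; exact hδ
    | succ t ih =>
      intro h
      rcases hcase t h with he | ⟨i, j, he⟩
      · rw [he]; exact ih h
      · rw [he]
        exact (fract_half_add_half _ _).imp id fun h => hδ2.trans_eq h.symm
  set L : ℕ := (K + 1) * n with hL
  have hwL : ∀ r, w (k * L + r) = w r := fun r => by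
    rw [hL, ← mul_assoc]; exact hwper _ r
  obtain ⟨a, ha⟩ := consensus_of_ceil_sweeps hG (n := n) (K := K) (w := w) hwG
    (fun e he l => by simpa only [hwper] using hw e he) (v := fun r => x (k * L + r) ω)
    (fun r i => (hbound _ i).1) (fun r i => (hbound _ i).2)
    (fun r hr i j hij he => by
      have hD := hk r hr
      simp only [hDdef, hwL, Set.mem_inter_iff, Set.mem_ofPred_eq] at hD
      obtain ⟨h₁, h₂⟩ := hupd (k * L + r) ω i j hij (hD.1.trans he)
      have hceil : ∀ i, qp (x (k * L + r) ω i) (U (k * L + r) ω i) = ⌈x (k * L + r) ω i⌉ :=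
        fun i => qp_eq_ceil (hU _ i) (hD.2 i trivial).2 (hfract _ i)
      rw [hceil, hceil] at h₁
      exact ⟨h₁, h₂⟩) (by omega)
  refine ⟨k * L + L, a, fun i t ht => ?_⟩
  induction t, ht using Nat.le_induction generalizing i with
  | base => exact ha i
  | succ t _ ih =>
    rcases hcase t i with he | ⟨j, l, he⟩
    · rw [he, ih]
    · rw [he, ih, ih, qp_intCast (hU t j), qp_intCast (hU t l)]
      ring
end

section
/- Let N ≥ 2, let G be a connected simple graph on the vertex set Fin N, and let (σ_t)_{t∈ℕ} be an i.i.d. sequence of edge-valued random variables on a probability space (Ω, P) such that P(σ_t = e) > 0 for every edge e of G. Let q_d(z) = ⌊z + 1/2⌋. Given x(0) ∈ ℝ^N, define x : ℕ → ℝ^N by: if σ_t = {i, j}, then x_{t+1}(i) = (1/2)x_t(i) + (1/2)q_d(x_t(j)) and x_{t+1}(j) = (1/2)x_t(j) + (1/2)q_d(x_t(i)), while x_{t+1}(h) = x_t(h) for h ∉ {i, j}. Then almost surely there exists T ∈ ℕ such that for all t ≥ T: |x_i(t) − x_j(t)| ≤ 1 for all i, j, and max_i |x_i(t) − x_ave(0)|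 ≤ 2, where x_ave(0) = (1/N)∑_{i} x_i(0). -/
open MeasureTheory

namespace QuantizedGossip

variable {V : Type*}

lemma floor_two_mul_update (a b : ℝ) :
    ⌊2 * ((1 / 2) * a + (1 / 2) * ((⌊b + 1 / 2⌋ : ℤ) : ℝ))⌋ =
      ⌊2 * a⌋ / 2 + (⌊2 * b⌋ + 1) / 2 := by
  have h1 : ⌊2 * a⌋ / 2 = ⌊a⌋ := by
    have h := Int.floor_div_natCast (2 * a) 2
    rw [← Nat.cast_ofNat (R := ℤ), ← h]
    congr 1
    push_cast
    ring
  have h2 : (⌊2 * b⌋ + 1) / 2 = ⌊b + 1 / 2⌋ := by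
    have h := Int.floor_div_natCast (2 * b + 1) 2
    rw [← Int.floor_add_one, ← Nat.cast_ofNat (R := ℤ), ← h]
    congr 1
    push_cast
    ring
  rw [h1, h2, ← Int.floor_add_intCast]
  congr 1
  ring

/-- All values differ by at most one. -/
def Balanced (n : V → ℤ) : Prop := ∀ i j, n i ≤ n j + 1

lemma Balanced.abs_sub_le_one {x : V → ℝ} (h : Balanced fun i => ⌊2 * x i⌋) (i j : V) :
    |x i - x j| ≤ 1 := by
  have key (i j : V) : x i - x j ≤ 1 := by
    have h1 : ((⌊2 * x i⌋ : ℤ) : ℝ) ≤ ⌊2 * x j⌋ + 1 := by exact_mod_cast h i j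
    linarith [Int.lt_floor_add_one (2 * x i), Int.floor_le (2 * x j)]
  rw [abs_sub_le_iff]
  exact ⟨key i j, key j i⟩

lemma Balanced.abs_sub_average_le [Fintype V] {x x0 : V → ℝ} (h : Balanced fun i => ⌊2 * x i⌋)
    (hsum : ∑ i, ⌊2 * x i⌋ = ∑ i, ⌊2 * x0 i⌋) (i : V) :
    |x i - (Fintype.card V : ℝ)⁻¹ * ∑ k, x0 k| ≤ 1 := by
  have hc : (0 : ℝ) < Fintype.card V := by exact_mod_cast Fintype.card_pos_iff.2 ⟨i⟩
  have hsum' : ∑ k, ((⌊2 * x k⌋ : ℤ) : ℝ) = ∑ k, ((⌊2 * x0 k⌋ : ℤ) : ℝ) := by exact_mod_cast hsum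
  have hle : ∑ k, ((⌊2 * x0 k⌋ : ℤ) : ℝ) ≤ ∑ k, 2 * x0 k :=
    Finset.sum_le_sum fun k _ => Int.floor_le _
  have hge : ∑ k, 2 * x0 k ≤ ∑ k, (((⌊2 * x0 k⌋ : ℤ) : ℝ) + 1) :=
    Finset.sum_le_sum fun k _ => (Int.lt_floor_add_one _).le
  have hle' : ∑ _k : V, ((⌊2 * x i⌋ : ℤ) : ℝ) ≤ ∑ k, (((⌊2 * x k⌋ : ℤ) : ℝ) + 1) :=
    Finset.sum_le_sum fun k _ => by exact_mod_cast h i k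
  have hge' : ∑ k, ((⌊2 * x k⌋ : ℤ) : ℝ) ≤ ∑ _k : V, (((⌊2 * x i⌋ : ℤ) : ℝ) + 1) :=
    Finset.sum_le_sum fun k _ => by exact_mod_cast h k i
  simp only [Finset.sum_add_distrib, Finset.sum_const, Finset.card_univ, nsmul_eq_mul, mul_one,
    ← Finset.mul_sum] at hle hge hle' hge'
  have h1 := Int.floor_le (2 * x i)
  have h2 := (Int.lt_floor_add_one (2 * x i)).le
  have h3 := mul_le_mul_of_nonneg_left h1 hc.le
  have h4 := mul_le_mul_of_nonneg_left h2 hc.le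
  have hx : x i - (Fintype.card V : ℝ)⁻¹ * ∑ k, x0 k =
      (Fintype.card V * x i - ∑ k, x0 k) / Fintype.card V := by field_simp
  rw [hx, abs_le, le_div_iff₀ hc, div_le_iff₀ hc]
  constructor <;> linarith

/-- The quadratic Lyapunov function of the doubled-floor dynamics. -/
def energy [Fintype V] (n : V → ℤ) : ℤ := ∑ h, n h ^ 2

lemma energy_nonneg [Fintype V] (n : V → ℤ) : 0 ≤ energy n := Finset.sum_nonneg fun _ _ => sq_nonneg _

variable [DecidableEq V]

/-- The dynamics induced by the gossip update on the doubled floors `⌊2 x⌋`, for an interaction of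
the two agents in `p`. -/
def step (n : V → ℤ) (p : V × V) : V → ℤ := fun h =>
  if h = p.1 then n p.1 / 2 + (n p.2 + 1) / 2
  else if h = p.2 then n p.2 / 2 + (n p.1 + 1) / 2
  else n h

lemma step_fst (n : V → ℤ) (i j : V) : step n (i, j) i = n i / 2 + (n j + 1) / 2 := by
  simp [step]

lemma step_snd (n : V → ℤ) {i j : V} (hij : i ≠ j) :
    step n (i, j) j = n j / 2 + (n i + 1) / 2 := by
  simp [step, hij.symm]

lemma step_of_ne (n : V → ℤ) {i j h : V} (hi : h ≠ i) (hj : h ≠ j) : step n (i, j) h = n h := by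
  simp [step, hi, hj]

lemma Balanced.step {n : V → ℤ} (hn : Balanced n) (p : V × V) : Balanced (step n p) := by
  intro i j
  have h1 := hn p.1 p.2
  have h2 := hn p.2 p.1
  have h3 := hn p.1 j
  have h4 := hn p.2 j
  have h5 := hn i p.1
  have h6 := hn i p.2
  have h7 := hn i j
  unfold QuantizedGossip.step
  split_ifs <;> omega

lemma Balanced.foldl_step {n : V → ℤ} (hn : Balanced n) (l : List (V × V)) :
    Balanced (l.foldl QuantizedGossip.step n) := by
  induction l generalizing n with
  | nil => exact hn
  | cons p l ih => exact ih (hn.step p)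

lemma step_mem_Icc {n : V → ℤ} {c d : ℤ} (hn : n ∈ Set.Icc (fun _ => c) (fun _ => d))
    (p : V × V) : step n p ∈ Set.Icc (fun _ => c) (fun _ => d) := by
  obtain ⟨h1, h2⟩ := hn
  have hc (i : V) : c ≤ n i := h1 i
  have hd (i : V) : n i ≤ d := h2 i
  refine ⟨fun i => ?_, fun i => ?_⟩ <;>
  · have := hc p.1
    have := hc p.2
    have := hd p.1
    have := hd p.2
    have := hc i
    have := hd i
    simp only [step]
    split_ifs <;> omega

section Energy

variable [Fintype V]

lemma sum_step (n : V → ℤ) {i j : V} (hij : i ≠ j) (f : ℤ → ℤ) :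
    ∑ h, f (step n (i, j) h) - ∑ h, f (n h) =
      f (n i / 2 + (n j + 1) / 2) + f (n j / 2 + (n i + 1) / 2) - f (n i) - f (n j) := by
  rw [← Finset.sum_sub_distrib, ← Finset.sum_subset (Finset.subset_univ {i, j}),
    Finset.sum_pair hij, step_fst, step_snd n hij]
  · ring
  · intro h _ hh
    simp only [Finset.mem_insert, Finset.mem_singleton, not_or] at hh
    rw [step_of_ne n hh.1 hh.2, sub_self]

lemma sum_step_eq (n : V → ℤ) {i j : V} (hij : i ≠ j) : ∑ h, step n (i, j) h = ∑ h, n h := by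
  have h := sum_step n hij id
  simp only [id] at h
  omega

lemma two_mul_energy_step_sub (n : V → ℤ) {i j : V} (hij : i ≠ j) :
    2 * (energy (step n (i, j)) - energy n) = (n j % 2 - n i % 2) ^ 2 - (n i - n j) ^ 2 := by
  unfold energy
  rw [sum_step n hij (· ^ 2)]
  have h1 : (n i + 1) / 2 = n i - n i / 2 := by omega
  have h2 : (n j + 1) / 2 = n j - n j / 2 := by omega
  have h3 : n i % 2 = n i - 2 * (n i / 2) := by omega
  have h4 : n j % 2 = n j - 2 * (n j / 2) := by omega
  simp only [h1, h2, h3, h4]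
  ring

lemma energy_step_lt (n : V → ℤ) {i j : V} (hd : n i + 2 ≤ n j) :
    energy (step n (i, j)) < energy n := by
  have hij : i ≠ j := by rintro rfl; omega
  have h := two_mul_energy_step_sub n hij
  have h1 : (n j % 2 - n i % 2) ^ 2 ≤ 1 := by
    rcases Int.emod_two_eq_zero_or_one (n i) with h | h <;>
    rcases Int.emod_two_eq_zero_or_one (n j) with h' | h' <;> simp [h, h']
  nlinarith

lemma energy_step_of_succ (n : V → ℤ) {i j : V} (hd : n j = n i + 1) :
    energy (step n (i, j)) = energy n := by
  have hij : i ≠ j := by rintro rfl; omega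
  have h := two_mul_energy_step_sub n hij
  have h1 : (n j % 2 - n i % 2) ^ 2 = 1 := by
    have : n j % 2 - n i % 2 = 1 ∨ n j % 2 - n i % 2 = -1 := by omega
    rcases this with h | h <;> simp [h]
  have h2 : (n i - n j) ^ 2 = 1 := by rw [hd]; ring
  omega

variable {G : SimpleGraph V}

/-- Along a walk joining two values that differ by at least two, swaps bring these values next to
each other, and their interaction then lowers the energy. -/
lemma exists_energy_lt_of_walk (k : ℕ) (n : V → ℤ) (u v : V) (w : G.Walk u v)
    (hw : w.length = k) (hd : n u + 2 ≤ n v) :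
    ∃ l : List (V × V), (∀ p ∈ l, G.Adj p.1 p.2) ∧ energy (l.foldl step n) < energy n := by
  induction k generalizing n u v with
  | zero =>
    obtain rfl := SimpleGraph.Walk.eq_of_length_eq_zero hw
    omega
  | succ k ih =>
    have hstep {a b : V} (hab : G.Adj a b) (h : n a + 2 ≤ n b) :
        ∃ l : List (V × V), (∀ p ∈ l, G.Adj p.1 p.2) ∧ energy (l.foldl step n) < energy n :=
      ⟨[(a, b)], by simpa using hab, energy_step_lt n h⟩
    have hswap {a b c d : V} (hab : G.Adj a b) (he : n b = n a + 1) (w : G.Walk c d)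
        (hw : w.length = k) (h : step n (a, b) c + 2 ≤ step n (a, b) d) :
        ∃ l : List (V × V), (∀ p ∈ l, G.Adj p.1 p.2) ∧ energy (l.foldl step n) < energy n := by
      obtain ⟨l, hl, hE⟩ := ih (step n (a, b)) c d w hw h
      refine ⟨(a, b) :: l, ?_, ?_⟩
      · simpa [hab] using hl
      · rw [energy_step_of_succ n he] at hE
        exact hE
    rcases Int.emod_two_eq_zero_or_one (n u) with hu | hu
    · cases w with
      | nil => omega
      | @cons _ z _ hz p =>
        have hp : p.length = k := by simpa using hw
        by_cases h1 : n u + 2 ≤ n z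
        · exact hstep hz h1
        by_cases h2 : n z + 2 ≤ n v
        · exact ih n z v p hp h2
        have hvu : v ≠ u := by rintro rfl; omega
        have hvz : v ≠ z := by rintro rfl; omega
        refine hswap hz (by omega) p hp ?_
        rw [step_snd n hz.ne, step_of_ne n hvu hvz]
        omega
    · have hw' : w.reverse.length = k + 1 := by simpa using hw
      generalize w.reverse = w' at hw'
      cases w' with
      | nil => omega
      | @cons _ z _ hz p =>
        have hp : p.reverse.length = k := by simpa using hw'
        by_cases h1 : n z + 2 ≤ n v
        · exact hstep hz.symm h1
        by_cases h2 : n u + 2 ≤ n z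
        · exact ih n u z p.reverse hp h2
        have huz : u ≠ z := by rintro rfl; omega
        have huv : u ≠ v := by rintro rfl; omega
        refine hswap hz.symm (by omega) p.reverse hp ?_
        rw [step_fst, step_of_ne n huz huv]
        omega

lemma exists_balanced_foldl (hG : G.Connected) (n : V → ℤ) :
    ∃ l : List (V × V), (∀ p ∈ l, G.Adj p.1 p.2) ∧ Balanced (l.foldl step n) := by
  induction hk : (energy n).toNat using Nat.strong_induction_on generalizing n with
  | _ k ih =>
    by_cases hn : Balanced n
    · exact ⟨[], by simp, hn⟩
    simp only [Balanced, not_forall, not_le] at hn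
    obtain ⟨v, u, huv⟩ := hn
    obtain ⟨w⟩ := hG.preconnected u v
    obtain ⟨l, hl, hE⟩ := exists_energy_lt_of_walk w.length n u v w rfl (by omega)
    have h0 := energy_nonneg (l.foldl step n)
    obtain ⟨l', hl', hb⟩ := ih _ (by omega) (l.foldl step n) rfl
    refine ⟨l ++ l', ?_, by rwa [List.foldl_append]⟩
    intro p hp
    rcases List.mem_append.1 hp with h | h
    exacts [hl p h, hl' p h]

/-- A single word of interactions balances every configuration of a finite set. -/
lemma exists_forall_mem_balanced_foldl (hG : G.Connected) {S : Set (V → ℤ)} (hS : S.Finite) :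
    ∃ l : List (V × V), (∀ p ∈ l, G.Adj p.1 p.2) ∧ ∀ n ∈ S, Balanced (l.foldl step n) := by
  induction S, hS using Set.Finite.induction_on with
  | empty => exact ⟨[], by simp, by simp⟩
  | @insert n S _ _ ih =>
    obtain ⟨l, hl, hb⟩ := ih
    obtain ⟨l', hl', hb'⟩ := exists_balanced_foldl hG (l.foldl step n)
    refine ⟨l ++ l', ?_, ?_⟩
    · intro p hp
      rcases List.mem_append.1 hp with h | h
      exacts [hl p h, hl' p h]
    · rintro m (rfl | hm)
      · rwa [List.foldl_append]
      · rw [List.foldl_append]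
        exact (hb m hm).foldl_step l'

end Energy

end QuantizedGossip

open QuantizedGossip

section Word

variable {Ω α : Type*} [MeasurableSpace Ω] {P : Measure Ω} [IsProbabilityMeasure P]

/-- In an i.i.d. sequence, every finite word whose letters have positive probability
almost surely occurs. -/
lemma ae_exists_word {σ : ℕ → Ω → α}
    (hmeas : ∀ (t : ℕ) (e : α), MeasurableSet {ω | σ t ω = e})
    (hiid : ∀ (s : Finset ℕ) (f : ℕ → α),
      P (⋂ t ∈ s, {ω | σ t ω = f t}) = ∏ t ∈ s, P {ω | σ 0 ω = f t})
    (l : ℕ) (g : ℕ → α) (hg : ∀ r < l, 0 < P {ω | σ 0 ω = g r}) :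
    ∀ᵐ ω ∂P, ∃ T, ∀ r < l, σ (T + r) ω = g r := by
  classical
  rcases Nat.eq_zero_or_pos l with rfl | hl
  · simp
  set B : ℕ → Finset ℕ := fun b => (Finset.range l).image (fun r => b * l + r) with hB
  set f : ℕ → α := fun t => g (t % l) with hf
  set A : ℕ → Set Ω := fun b => ⋂ t ∈ B b, {ω | σ t ω = f t} with hA
  have hAm (b : ℕ) : MeasurableSet (A b) :=
    Finset.measurableSet_biInter _ fun t _ => hmeas t _
  have hdisj : ∀ b b', b ≠ b' → Disjoint (B b) (B b') := by
    intro b b' hbb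
    rw [Finset.disjoint_left]
    intro t ht ht'
    simp only [hB, Finset.mem_image, Finset.mem_range] at ht ht'
    obtain ⟨r, hr, rfl⟩ := ht
    obtain ⟨r', hr', h⟩ := ht'
    apply hbb
    have h1 := congrArg (· / l) h
    simpa [Nat.add_comm _ r, Nat.add_comm _ r', Nat.add_mul_div_right _ _ hl,
      Nat.div_eq_of_lt hr, Nat.div_eq_of_lt hr'] using h1.symm
  have hPA (b : ℕ) : P (A b) = ∏ r ∈ Finset.range l, P {ω | σ 0 ω = g r} := by
    rw [hA, hiid, hB, Finset.prod_image (by intro a _ b _ h; simpa using h)]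
    refine Finset.prod_congr rfl fun r hr => ?_
    simp [hf, Nat.add_comm _ r, Nat.mod_eq_of_lt (Finset.mem_range.1 hr)]
  have hind : ProbabilityTheory.iIndepSet A P := by
    rw [ProbabilityTheory.iIndepSet_iff_meas_biInter hAm]
    intro s
    have hU : ⋂ b ∈ s, A b = ⋂ t ∈ s.biUnion B, {ω | σ t ω = f t} := by
      rw [Finset.set_biInter_biUnion]
    rw [hU, hiid, Finset.prod_biUnion fun b _ b' _ h => hdisj b b' h]
    exact Finset.prod_congr rfl fun b _ => (hiid _ _).symm
  have hlim := ProbabilityTheory.measure_limsup_eq_one hAm hind (by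
    simp only [hPA]
    refine ENNReal.tsum_const_eq_top_of_ne_zero ?_
    exact Finset.prod_ne_zero_iff.2 fun r hr => (hg r (Finset.mem_range.1 hr)).ne')
  have hae : ∀ᵐ ω ∂P, ω ∈ Filter.limsup A Filter.atTop := by
    rw [← prob_compl_eq_zero_iff (MeasurableSet.measurableSet_limsup hAm)] at hlim
    exact hlim
  filter_upwards [hae] with ω hω
  rw [Filter.mem_limsup_iff_frequently_mem] at hω
  obtain ⟨b, hb⟩ := hω.exists
  refine ⟨b * l, fun r hr => ?_⟩
  have h1 := Set.mem_iInter₂.1 hb (b * l + r)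
    (Finset.mem_image_of_mem _ (Finset.mem_range.2 hr))
  simpa [hf, Nat.add_comm _ r, Nat.mod_eq_of_lt hr] using h1

end Word

/-- Partially quantized gossip algorithm with deterministic quantizer `q_d(z) = ⌊z + 1/2⌋`:
almost surely, in finite time, all states are within 1 of each other and within 2
of the initial average. -/
theorem stmt_6 {N : ℕ} (hN : 2 ≤ N) (G : SimpleGraph (Fin N)) (hG : G.Connected)
    {Ω : Type*} [MeasurableSpace Ω] (P : Measure Ω) [IsProbabilityMeasure P]
    (σ : ℕ → Ω → Sym2 (Fin N))
    (hrange : ∀ t ω, σ t ω ∈ G.edgeSet)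
    (hmeas : ∀ (t : ℕ) (e : Sym2 (Fin N)), MeasurableSet {ω | σ t ω = e})
    (hiid : ∀ (s : Finset ℕ) (f : ℕ → Sym2 (Fin N)),
      P (⋂ t ∈ s, {ω | σ t ω = f t}) = ∏ t ∈ s, P {ω | σ 0 ω = f t})
    (hpos : ∀ e ∈ G.edgeSet, 0 < P {ω | σ 0 ω = e})
    (x0 : Fin N → ℝ) (x : ℕ → Ω → Fin N → ℝ)
    (h0 : ∀ ω, x 0 ω = x0)
    (hupd : ∀ (t : ℕ) (ω : Ω) (i j : Fin N), G.Adj i j → σ t ω = s(i, j) →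
      x (t+1) ω i = (1/2) * x t ω i + (1/2) * ((⌊x t ω j + 1/2⌋ : ℤ) : ℝ) ∧
      ∀ h : Fin N, h ≠ i → h ≠ j → x (t+1) ω h = x t ω h) :
    ∀ᵐ ω ∂P, ∃ T : ℕ, ∀ t ≥ T,
      (∀ i j, |x t ω i - x t ω j| ≤ 1) ∧
      (∀ i, |x t ω i - (N : ℝ)⁻¹ * ∑ k, x0 k| ≤ 2) := by
  classical
  set y : ℕ → Ω → Fin N → ℤ := fun t ω i => ⌊2 * x t ω i⌋ with hy
  have hstep (t : ℕ) (ω : Ω) (i j : Fin N) (hij : G.Adj i j) (hs : σ t ω = s(i, j)) :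
      y (t + 1) ω = step (y t ω) (i, j) := by
    obtain ⟨h1, h3⟩ := hupd t ω i j hij hs
    obtain ⟨h2, -⟩ := hupd t ω j i hij.symm (hs.trans Sym2.eq_swap)
    funext h
    by_cases hi : h = i
    · subst hi
      rw [step_fst]
      simp only [hy, h1, floor_two_mul_update]
    by_cases hj : h = j
    · subst hj
      rw [step_snd _ hij.ne]
      simp only [hy, h2, floor_two_mul_update]
    · rw [step_of_ne _ hi hj]
      simp only [hy, h3 h hi hj]
  have hedge (t : ℕ) (ω : Ω) : ∃ i j, G.Adj i j ∧ y (t + 1) ω = step (y t ω) (i, j) := by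
    have hr := hrange t ω
    obtain ⟨i, j, hs⟩ : ∃ i j, σ t ω = s(i, j) := by
      induction h : σ t ω with | _ i j => exact ⟨i, j, rfl⟩
    rw [hs, SimpleGraph.mem_edgeSet] at hr
    exact ⟨i, j, hr, hstep t ω i j hr hs⟩
  obtain ⟨c, hc⟩ := (Set.finite_range fun i => ⌊2 * x0 i⌋).bddBelow
  obtain ⟨d, hd⟩ := (Set.finite_range fun i => ⌊2 * x0 i⌋).bddAbove
  have hbox (t : ℕ) (ω : Ω) : y t ω ∈ Set.Icc (fun _ => c) (fun _ => d) := by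
    induction t with
    | zero =>
      simp only [hy, h0]
      exact ⟨fun i => hc ⟨i, rfl⟩, fun i => hd ⟨i, rfl⟩⟩
    | succ t ih =>
      obtain ⟨i, j, -, h⟩ := hedge t ω
      rw [h]
      exact step_mem_Icc ih _
  have hsum (t : ℕ) (ω : Ω) : ∑ i, y t ω i = ∑ i, ⌊2 * x0 i⌋ := by
    induction t with
    | zero => simp only [hy, h0]
    | succ t ih =>
      obtain ⟨i, j, hij, h⟩ := hedge t ω
      rw [h, sum_step_eq _ hij.ne, ih]
  obtain ⟨l, hl, hbal⟩ := exists_forall_mem_balanced_foldl hG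
    (Set.finite_Icc (fun _ : Fin N => c) (fun _ => d))
  let v : Fin N := ⟨0, by omega⟩
  set g : ℕ → Fin N × Fin N := fun r => l.getD r (v, v) with hgdef
  have hgl (r : ℕ) (hr : r < l.length) : g r = l[r] := by simp [hgdef, hr]
  have hadj (r : ℕ) (hr : r < l.length) : G.Adj (g r).1 (g r).2 := by
    rw [hgl r hr]
    exact hl _ (List.getElem_mem hr)
  have hword := ae_exists_word (P := P) hmeas hiid l.length (fun r => s((g r).1, (g r).2))
    fun r hr => hpos _ ((SimpleGraph.mem_edgeSet G).2 (hadj r hr))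
  filter_upwards [hword] with ω ⟨T, hT⟩
  have hrun (r : ℕ) (hr : r ≤ l.length) : y (T + r) ω = (l.take r).foldl step (y T ω) := by
    induction r with
    | zero => simp
    | succ r ih =>
      rw [← add_assoc, hstep (T + r) ω _ _ (hadj r hr) (hT r hr), ih (by omega),
        ← List.take_concat_get' l r hr, List.foldl_append, hgl r hr]
      rfl
  have hbalanced (t : ℕ) (ht : T + l.length ≤ t) : Balanced (y t ω) := by
    induction t, ht using Nat.le_induction with
    | base =>
      rw [hrun _ le_rfl, List.take_length]
      exact hbal _ (hbox T ω)
    | succ t _ ih =>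
      obtain ⟨i, j, -, h⟩ := hedge t ω
      rw [h]
      exact ih.step _
  refine ⟨T + l.length, fun t ht => ⟨(hbalanced t ht).abs_sub_le_one, fun i => ?_⟩⟩
  have h := (hbalanced t ht).abs_sub_average_le (hsum t ω) i
  rw [Fintype.card_fin] at h
  linarith
end
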